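/- Assume (H1)–(H6), (H7): for every x ∈ Ω̄ and every sequence xₙ → x in Ω̄, the geodesic distance in Ω̄ satisfies dist_geo(xₙ, x) → 0; and (H8): there exists α* > 0 with ℓ(t,x,p) ≤ α*|p|^θ for all (t,x,p). Let m₀ ∈ 𝓟(Ω̄). Then Q ∈ 𝓟(Γ) is an equilibrium of the mean field game with initial condition m₀ (i.e., (e₀)_#Q = m₀, ∫_Γ F(γ,Q) dQ(γ) < +∞, and for Q-almost every γ, F(γ,Q) = inf{F(ω,Q) : ω(0) = γ(0)}) if and only if Q is a strong equilibrium (the same conditions with 'for Q-almost every γ' replaced by 'for every γ ∈ supp Q'). -/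

import Mathlib

open MeasureTheory Filter Topology Set
open scoped ENNReal NNReal

noncomputable section

/-- Euclidean space `ℝ^d`. -/
abbrev EucSp (d : ℕ) := EuclideanSpace ℝ (Fin d)

/-- The space `Γ = C(ℝ₊, Ω̄)` of continuous curves with values in `closure Ω`, endowed with
the topology of uniform convergence on compact time intervals (the compact-open topology). -/
abbrev CurveSp {d : ℕ} (Ω : Set (EucSp d)) :=
  {γ : C(ℝ≥0, EucSp d) // ∀ t : ℝ≥0, γ t ∈ closure Ω}

variable {d : ℕ}

/-- `γ` is absolutely continuous with (locally integrable) velocity `g`. -/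
def HasVel {Ω : Set (EucSp d)} (γ : CurveSp Ω) (g : ℝ → EucSp d) : Prop :=
  (∀ T : ℝ, IntegrableOn g (Set.Icc 0 T) volume) ∧
    ∀ t : ℝ≥0, γ.1 t = γ.1 0 + ∫ s in Set.Ioc (0 : ℝ) (t : ℝ), g s

/-- The first exit time `τ(γ) = inf {t ≥ 0 | γ(t) ∈ Ξ}`, with value `+∞` if `γ` never
reaches `Ξ`. -/
def exitT {Ω : Set (EucSp d)} (Ξ : Set (EucSp d)) (γ : CurveSp Ω) : ℝ≥0∞ :=
  ⨅ (t : ℝ≥0) (_ : γ.1 t ∈ Ξ), (t : ℝ≥0∞)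

/-- The extension of a nondecreasing `Ψ : ℝ₊ → ℝ₊` to `[0,+∞]`: for finite `T` it coincides
with `Ψ(T)` (as `Ψ` is nondecreasing), and `Ψ(+∞) = sup Ψ`. -/
def PsiExt (Ψ : ℝ → ℝ) (T : ℝ≥0∞) : ℝ≥0∞ :=
  ⨆ (t : ℝ≥0) (_ : (t : ℝ≥0∞) ≤ T), ENNReal.ofReal (Ψ (t : ℝ))

/-- The individual cost `L(γ) = ∫₀^∞ ℓ(t,γ(t),γ̇(t)) dt + Ψ(τ(γ))` if `γ` is absolutely
continuous, and `L(γ) = +∞` otherwise (the infimum over an empty family is `+∞`; any two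
velocities of `γ` agree a.e., so the infimum is the common value of the integral). -/
def Lcost {Ω : Set (EucSp d)} (ℓ : ℝ → EucSp d → EucSp d → ℝ) (Ψ : ℝ → ℝ)
    (Ξ : Set (EucSp d)) (γ : CurveSp Ω) : ℝ≥0∞ :=
  (⨅ (g : ℝ → EucSp d) (_ : HasVel γ g),
    ∫⁻ t in Set.Ioi (0 : ℝ), ENNReal.ofReal (ℓ t (γ.1 t.toNNReal) (g t))) +
  PsiExt Ψ (exitT Ξ γ)

/-- The raw pairwise interaction cost
`∫₀^{τ(γ) ∧ τ(γ̃)} h(t,γ(t),γ̃(t),γ̇(t),γ̃̇(t)) dt`, equal to `+∞` when one of the curves is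
not absolutely continuous. -/
def interCost {Ω : Set (EucSp d)}
    (h : ℝ → EucSp d → EucSp d → EucSp d → EucSp d → ℝ)
    (Ξ : Set (EucSp d)) (γ γ' : CurveSp Ω) : ℝ≥0∞ :=
  ⨅ (g : ℝ → EucSp d) (_ : HasVel γ g) (g' : ℝ → EucSp d) (_ : HasVel γ' g'),
    ∫⁻ t in {t : ℝ | 0 < t ∧ ENNReal.ofReal t < min (exitT Ξ γ) (exitT Ξ γ')},
      ENNReal.ofReal (h t (γ.1 t.toNNReal) (γ'.1 t.toNNReal) (g t) (g' t))

/-- The interaction cost `H(γ,γ̃)`, equal to the raw interaction cost when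
`L(γ) < +∞` and `L(γ̃) < +∞`, and to `+∞` otherwise. -/
def Hcost {Ω : Set (EucSp d)} (ℓ : ℝ → EucSp d → EucSp d → ℝ) (Ψ : ℝ → ℝ)
    (h : ℝ → EucSp d → EucSp d → EucSp d → EucSp d → ℝ)
    (Ξ : Set (EucSp d)) (γ γ' : CurveSp Ω) : ℝ≥0∞ :=
  if Lcost ℓ Ψ Ξ γ ≠ ⊤ ∧ Lcost ℓ Ψ Ξ γ' ≠ ⊤ then interCost h Ξ γ γ' else ⊤

instance {Ω : Set (EucSp d)} : MeasurableSpace (CurveSp Ω) := borel _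
instance {Ω : Set (EucSp d)} : BorelSpace (CurveSp Ω) := ⟨rfl⟩

/-- The total cost `F(γ,Q)` from the mean field game, with the conventions of the paper:
`F(γ,Q) = +∞` if `γ` is not absolutely continuous, if `Q` gives positive measure to
non-absolutely-continuous curves, or if the inner interaction integral is not `Q`-integrable. -/
def F1cost {Ω : Set (EucSp d)} (ℓ : ℝ → EucSp d → EucSp d → ℝ) (Ψ : ℝ → ℝ)
    (h : ℝ → EucSp d → EucSp d → EucSp d → EucSp d → ℝ)
    (Ξ : Set (EucSp d)) (γ : CurveSp Ω) (Q : Measure (CurveSp Ω)) : ℝ≥0∞ :=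
  if Q {γ' : CurveSp Ω | ¬ ∃ g : ℝ → EucSp d, HasVel γ' g} = 0 then
    Lcost ℓ Ψ Ξ γ + ∫⁻ γ', interCost h Ξ γ γ' ∂Q
  else ⊤

/-- The total cost `F(γ,Q) = L(γ) + ∫ H(γ,·) dQ` of the associated abstract non-atomic game. -/
def F2cost {Ω : Set (EucSp d)} (ℓ : ℝ → EucSp d → EucSp d → ℝ) (Ψ : ℝ → ℝ)
    (h : ℝ → EucSp d → EucSp d → EucSp d → EucSp d → ℝ)
    (Ξ : Set (EucSp d)) (γ : CurveSp Ω) (Q : Measure (CurveSp Ω)) : ℝ≥0∞ :=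
  Lcost ℓ Ψ Ξ γ + ∫⁻ γ', Hcost ℓ Ψ h Ξ γ γ' ∂Q

/-- The geodesic (intrinsic) distance in `S`: the infimum of the lengths (total variations)
of continuous paths in `S` joining `x` to `y`. -/
def geoDist {d : ℕ} (S : Set (EucSp d)) (x y : EucSp d) : ℝ≥0∞ :=
  ⨅ (f : ℝ → EucSp d) (_ : ContinuousOn f (Set.Icc 0 1))
    (_ : ∀ t ∈ Set.Icc (0 : ℝ) 1, f t ∈ S) (_ : f 0 = x) (_ : f 1 = y),
    eVariationOn f (Set.Icc 0 1)

/-- A bounded family in a Hilbert space converges weakly along any ultrafilter. -/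
theorem exists_weak_limit_ultrafilter {H ι : Type*} [NormedAddCommGroup H]
    [InnerProductSpace ℝ H] [CompleteSpace H] (𝒰 : Ultrafilter ι) (x : ι → H) (R : ℝ)
    (hx : ∀ i, ‖x i‖ ≤ R) :
    ∃ u : H, ∀ v : H, Tendsto (fun i => inner ℝ (x i) v) 𝒰 (𝓝 (inner ℝ u v)) := by
  let y : ι → WeakDual ℝ H := fun i =>
    StrongDual.toWeakDual (InnerProductSpace.toDual ℝ H (x i))
  have hK := WeakDual.isCompact_closedBall (𝕜 := ℝ) (E := H) 0 R
  obtain ⟨w, -, hw⟩ := hK.ultrafilter_le_nhds (𝒰.map y) (by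
    simp only [le_principal_iff]
    refine Filter.mem_map.2 (Filter.univ_mem' fun i => ?_)
    simp only [mem_preimage, Metric.mem_closedBall, dist_zero_right]
    change ‖InnerProductSpace.toDual ℝ H (x i)‖ ≤ R
    simpa using hx i)
  refine ⟨(InnerProductSpace.toDual ℝ H).symm (WeakDual.toStrongDual w), fun v => ?_⟩
  have h1 : Tendsto y 𝒰 (𝓝 w) := hw
  have h2 : Tendsto (fun i => y i v) 𝒰 (𝓝 (w v)) :=
    ((WeakDual.eval_continuous v).tendsto w).comp h1
  rw [InnerProductSpace.toDual_symm_apply]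
  exact h2

/-- Closed convex sets of a Hilbert space are closed under weak limits. -/
theorem mem_of_weak_limit {H ι : Type*} [NormedAddCommGroup H]
    [InnerProductSpace ℝ H] [CompleteSpace H] {l : Filter ι} [l.NeBot] {x : ι → H} {u : H}
    (hu : ∀ v : H, Tendsto (fun i => inner ℝ (x i) v) l (𝓝 (inner ℝ u v)))
    {D : Set H} (hD : IsClosed D) (hDc : Convex ℝ D) (hx : ∀ᶠ i in l, x i ∈ D) : u ∈ D := by
  by_contra hn
  obtain ⟨f, c, h1, h2⟩ := geometric_hahn_banach_point_closed hDc hD hn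
  have hf : ∀ z, f z = inner ℝ z ((InnerProductSpace.toDual ℝ H).symm f) := fun z => by
    rw [real_inner_comm, InnerProductSpace.toDual_symm_apply]
  have h3 : Tendsto (fun i => f (x i)) l (𝓝 (f u)) := by
    simpa only [hf] using hu ((InnerProductSpace.toDual ℝ H).symm f)
  have : c ≤ f u := ge_of_tendsto h3 (hx.mono fun i hi => (h2 _ hi).le)
  linarith

section ConvexIntegral

variable {α V : Type*} [MeasurableSpace α] [NormedAddCommGroup V] {ν ν' : Measure α}

/-- Sublevel sets of a convex integral functional on `L²` are closed. -/
theorem isClosed_sublevel_convexIntegral (hac : ν' ≪ ν) {f : α → V → ℝ}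
    (hmeas : ∀ u : α → V, AEStronglyMeasurable u ν → AEMeasurable (fun a => f a (u a)) ν')
    (hcont : ∀ᵐ a ∂ν', Continuous (f a)) (c : ℝ≥0∞) :
    IsClosed {u : Lp V 2 ν | ∫⁻ a, ENNReal.ofReal (f a (u a)) ∂ν' ≤ c} := by
  refine IsSeqClosed.isClosed fun u v hu huv => ?_
  obtain ⟨ns, -, hns⟩ := (tendstoInMeasure_of_tendsto_Lp huv).exists_seq_tendsto_ae
  calc ∫⁻ a, ENNReal.ofReal (f a (v a)) ∂ν'
      = ∫⁻ a, liminf (fun k => ENNReal.ofReal (f a (u (ns k) a))) atTop ∂ν' := by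
        refine lintegral_congr_ae ?_
        filter_upwards [hac.ae_le hns, hcont] with a ha hc
        exact ((ENNReal.continuous_ofReal.tendsto _).comp
          ((hc.tendsto _).comp ha)).liminf_eq.symm
    _ ≤ liminf (fun k => ∫⁻ a, ENNReal.ofReal (f a (u (ns k) a)) ∂ν') atTop :=
        lintegral_liminf_le' fun k =>
          (hmeas _ (Lp.aestronglyMeasurable _)).ennreal_ofReal
    _ ≤ c := by
        refine (liminf_le_liminf (v := fun _ => c)
          (Eventually.of_forall fun k => hu (ns k))).trans ?_
        simp

/-- Sublevel sets of a convex integral functional on `L²` are convex. -/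
theorem convex_sublevel_convexIntegral [NormedSpace ℝ V] (hac : ν' ≪ ν) {f : α → V → ℝ}
    (hmeas : ∀ u : α → V, AEStronglyMeasurable u ν → AEMeasurable (fun a => f a (u a)) ν')
    (hconv : ∀ᵐ a ∂ν', ConvexOn ℝ univ (f a)) (hnn : ∀ᵐ a ∂ν', ∀ v, 0 ≤ f a v) (c : ℝ≥0∞) :
    Convex ℝ {u : Lp V 2 ν | ∫⁻ a, ENNReal.ofReal (f a (u a)) ∂ν' ≤ c} := by
  intro u hu v hv s t hs ht hst
  have hum := (hmeas _ (Lp.aestronglyMeasurable u)).ennreal_ofReal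
  have hvm := (hmeas _ (Lp.aestronglyMeasurable v)).ennreal_ofReal
  calc ∫⁻ a, ENNReal.ofReal (f a ((s • u + t • v : Lp V 2 ν) a)) ∂ν'
      ≤ ∫⁻ a, (ENNReal.ofReal s * ENNReal.ofReal (f a (u a)) +
          ENNReal.ofReal t * ENNReal.ofReal (f a (v a))) ∂ν' := by
        refine lintegral_mono_ae ?_
        filter_upwards [hac.ae_le (Lp.coeFn_add (s • u) (t • v)), hac.ae_le (Lp.coeFn_smul s u),
          hac.ae_le (Lp.coeFn_smul t v), hconv, hnn] with a h1 h2 h3 h4 h5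
        rw [h1, Pi.add_apply, h2, h3, Pi.smul_apply, Pi.smul_apply, ← ENNReal.ofReal_mul hs,
          ← ENNReal.ofReal_mul ht, ← ENNReal.ofReal_add (mul_nonneg hs (h5 _))
          (mul_nonneg ht (h5 _))]
        exact ENNReal.ofReal_le_ofReal (h4.2 (mem_univ _) (mem_univ _) hs ht hst)
    _ = ENNReal.ofReal s * ∫⁻ a, ENNReal.ofReal (f a (u a)) ∂ν' +
          ENNReal.ofReal t * ∫⁻ a, ENNReal.ofReal (f a (v a)) ∂ν' := by
        rw [lintegral_add_left' (hum.const_mul _), lintegral_const_mul'' _ hum,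
          lintegral_const_mul'' _ hvm]
    _ ≤ ENNReal.ofReal s * c + ENNReal.ofReal t * c :=
        add_le_add (mul_le_mul_right hu _) (mul_le_mul_right hv _)
    _ = c := by rw [← add_mul, ← ENNReal.ofReal_add hs ht, hst]; simp

end ConvexIntegral

/-- Truncation of vectors of norm larger than `M` to `0`. -/
def truncVec {V : Type*} [NormedAddCommGroup V] (M : ℝ) (v : V) : V :=
  open Classical in if ‖v‖ ≤ M then v else 0

section Trunc
variable {V : Type*} [NormedAddCommGroup V]

theorem truncVec_eq_or (M : ℝ) (v : V) : truncVec M v = v ∨ truncVec M v = 0 := by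
  unfold truncVec; split_ifs <;> simp

theorem norm_truncVec_le {M : ℝ} (hM : 0 ≤ M) (v : V) : ‖truncVec M v‖ ≤ M := by
  unfold truncVec; split_ifs with h <;> simp [h, hM]

theorem norm_truncVec_sub_le {M N : ℝ} (h : M ≤ N) (v : V) :
    ‖truncVec N v - truncVec M v‖ ≤ ‖v - truncVec M v‖ := by
  unfold truncVec
  split_ifs with h1 h2 h2 <;> simp
  exact absurd (h2.trans h) h1

theorem measurable_truncVec [MeasurableSpace V] [BorelSpace V] (M : ℝ) :
    Measurable (truncVec M : V → V) := by
  unfold truncVec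
  exact Measurable.ite (measurableSet_le measurable_norm measurable_const) measurable_id
    measurable_const

end Trunc

section DunfordPettis

variable {α V : Type*} [MeasurableSpace α] [NormedAddCommGroup V] [InnerProductSpace ℝ V]
  [CompleteSpace V] [MeasurableSpace V] [BorelSpace V] [SecondCountableTopology V]
  {ν : Measure α} [IsFiniteMeasure ν] {ι : Type*}

theorem aestronglyMeasurable_truncVec {α V : Type*} [MeasurableSpace α] [NormedAddCommGroup V]
    [MeasurableSpace V] [BorelSpace V] [SecondCountableTopology V] {ν : Measure α}
    {g : α → V} (hg : AEStronglyMeasurable g ν) (M : ℝ) :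
    AEStronglyMeasurable (fun a => truncVec M (g a)) ν :=
  ((measurable_truncVec M).comp_aemeasurable hg.aemeasurable).aestronglyMeasurable

theorem memLp_truncVec {α V : Type*} [MeasurableSpace α] [NormedAddCommGroup V]
    [MeasurableSpace V] [BorelSpace V] [SecondCountableTopology V] {ν : Measure α}
    [IsFiniteMeasure ν] {g : α → V} (hg : AEStronglyMeasurable g ν) (k : ℕ) (p : ℝ≥0∞) :
    MemLp (fun a => truncVec (k : ℝ) (g a)) p ν :=
  MemLp.of_bound (aestronglyMeasurable_truncVec hg k) k
    (Eventually.of_forall fun _ => norm_truncVec_le (Nat.cast_nonneg k) _)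

/-- A uniformly integrable family of vector valued functions on a finite measure space converges
weakly in `L¹` along any ultrafilter; the limit is an a.e. limit of the weak limits in `L²` of the
truncated functions. -/
theorem exists_weak_limit_of_uniformIntegrable (𝒰 : Ultrafilter ι) {g : ι → α → V}
    (hg : ∀ n, AEStronglyMeasurable (g n) ν) {δ : ℕ → ℝ≥0∞} (hδ : Tendsto δ atTop (𝓝 0))
    (hUI : ∀ n (k : ℕ), ∫⁻ a, ‖g n a - truncVec k (g n a)‖ₑ ∂ν ≤ δ k) :
    ∃ (G : α → V) (m : ℕ → ℕ) (w : ℕ → Lp V 2 ν), Integrable G ν ∧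
      (∀ k v, Tendsto (fun n => inner ℝ (((memLp_truncVec (hg n) (m k) 2).toLp)) v) 𝒰
        (𝓝 (inner ℝ (w k) v))) ∧
      (∀ᵐ a ∂ν, Tendsto (fun k => w k a) atTop (𝓝 (G a))) ∧
      ∀ ψ : α → V, AEStronglyMeasurable ψ ν → ∀ b : ℝ, (∀ a, ‖ψ a‖ ≤ b) →
        Tendsto (fun n => ∫ a, inner ℝ (g n a) (ψ a) ∂ν) 𝒰 (𝓝 (∫ a, inner ℝ (G a) (ψ a) ∂ν)) := by
  have hex : ∀ k : ℕ, ∃ w : Lp V 2 ν, ∀ v, Tendsto (fun n => inner ℝ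
      (((memLp_truncVec (hg n) k 2).toLp)) v) 𝒰 (𝓝 (inner ℝ w v)) := fun k => by
    refine exists_weak_limit_ultrafilter 𝒰 _
      ((measureUnivNNReal ν : ℝ) ^ (2 : ℝ≥0∞).toReal⁻¹ * k) fun n => ?_
    refine Lp.norm_le_of_ae_bound (Nat.cast_nonneg k) ?_
    filter_upwards [(memLp_truncVec (hg n) k 2).coeFn_toLp] with a ha
    rw [ha]
    exact norm_truncVec_le (Nat.cast_nonneg k) _
  choose W hW using hex
  have hWdiff : ∀ k l : ℕ, k ≤ l → ∫⁻ a, ‖W l a - W k a‖ₑ ∂ν ≤ δ k := fun k l hkl => by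
    have hm : ∀ u : α → V, AEStronglyMeasurable u ν → AEMeasurable (fun a => ‖u a‖) ν :=
      fun u hu => hu.norm.aemeasurable
    have hc := isClosed_sublevel_convexIntegral (V := V) (Measure.AbsolutelyContinuous.refl ν)
      hm (Eventually.of_forall fun _ => continuous_norm) (δ k)
    have hcv := convex_sublevel_convexIntegral (V := V) (Measure.AbsolutelyContinuous.refl ν)
      hm (Eventually.of_forall fun _ => convexOn_univ_norm)
      (Eventually.of_forall fun _ => norm_nonneg) (δ k)
    have := mem_of_weak_limit (l := (𝒰 : Filter ι)) (u := W l - W k)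
      (x := fun n => (memLp_truncVec (hg n) l 2).toLp - (memLp_truncVec (hg n) k 2).toLp)
      (fun v => by simpa only [inner_sub_left] using (hW l v).sub (hW k v)) hc hcv
      (Eventually.of_forall fun n => by
        simp only [mem_ofPred_eq, ofReal_norm]
        refine (lintegral_mono_ae ?_).trans (hUI n k)
        filter_upwards [Lp.coeFn_sub ((memLp_truncVec (hg n) l 2).toLp)
          ((memLp_truncVec (hg n) k 2).toLp), (memLp_truncVec (hg n) l 2).coeFn_toLp,
          (memLp_truncVec (hg n) k 2).coeFn_toLp] with a h1 h2 h3
        rw [h1, Pi.sub_apply, h2, h3]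
        exact enorm_le_iff_norm_le.2 (norm_truncVec_sub_le (Nat.cast_le.2 hkl) _))
    simp only [mem_ofPred_eq, ofReal_norm] at this
    refine (lintegral_mono_ae ?_).trans this
    filter_upwards [Lp.coeFn_sub (W l) (W k)] with a h1
    rw [h1, Pi.sub_apply]
  have hBpos : ∀ i : ℕ, (0 : ℝ≥0∞) < (2 : ℝ≥0∞)⁻¹ ^ i := fun i =>
    ENNReal.pow_pos (by simp) i
  have hm0 : ∀ i : ℕ, ∃ k : ℕ, ∀ l ≥ k, δ l < (2 : ℝ≥0∞)⁻¹ ^ i := fun i =>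
    eventually_atTop.1 (hδ.eventually_lt_const (hBpos i))
  choose m₀ hm₀ using hm0
  let m₁ : ℕ → ℕ := fun i => i + ∑ j ∈ Finset.range (i + 1), m₀ j
  have hm₁mono : Monotone m₁ := fun i j hij => by
    refine add_le_add hij (Finset.sum_le_sum_of_subset ?_)
    exact Finset.range_mono (by omega)
  have hm₁ : ∀ i, δ (m₁ i) < (2 : ℝ≥0∞)⁻¹ ^ i := fun i => hm₀ i _ <| by
    have := Finset.single_le_sum (f := m₀) (fun _ _ => Nat.zero_le _)
      (Finset.self_mem_range_succ i)
    simp only [m₁]; omega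
  have hW1 : ∀ k, MemLp (W k) 1 ν := fun k => (Lp.memLp (W k)).mono_exponent (by norm_num)
  obtain ⟨G, hG, hlim⟩ := Lp.cauchy_complete_eLpNorm (le_refl (1 : ℝ≥0∞))
    (f := fun i => (W (m₁ i) : α → V)) (fun i => hW1 _) (B := fun i => 2⁻¹ ^ i)
    (by rw [ENNReal.tsum_geometric]; simp) (by
      intro N i j hi hj
      rw [eLpNorm_one_eq_lintegral_enorm]
      have key : ∀ i j : ℕ, N ≤ i → i ≤ j →
          ∫⁻ a, ‖W (m₁ j) a - W (m₁ i) a‖ₑ ∂ν < 2⁻¹ ^ N := fun i j hi hij =>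
        (hWdiff _ _ (hm₁mono hij)).trans_lt ((hm₁ i).trans_le
          (pow_le_pow_right_of_le_one' (by simp) hi))
      rcases le_total i j with hij | hij
      · simpa only [Pi.sub_apply, enorm_sub_rev] using key i j hi hij
      · simpa only [Pi.sub_apply] using key j i hj hij)
  obtain ⟨ns, hns, hae⟩ := (tendstoInMeasure_of_tendsto_eLpNorm one_ne_zero
    (fun i => (hW1 _).1) hG.1 hlim).exists_seq_tendsto_ae
  have hGint : Integrable G ν := memLp_one_iff_integrable.1 hG
  refine ⟨G, fun k => m₁ (ns k), fun k => W (m₁ (ns k)), hGint, fun k => hW _, hae, ?_⟩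
  intro ψ hψ b hb
  have hδm : Tendsto (fun k => δ (m₁ k)) atTop (𝓝 0) := by
    refine hδ.comp (tendsto_atTop_mono (fun i => ?_) tendsto_id)
    simp [m₁]
  have hinner : ∀ u : α → V, Integrable u ν → Integrable (fun a => inner ℝ (u a) (ψ a)) ν :=
    fun u hu => (hu.norm.mul_const b).mono' (hu.1.inner hψ) (Eventually.of_forall fun a =>
      (norm_inner_le_norm _ _).trans (mul_le_mul_of_nonneg_left (hb a) (norm_nonneg _)))
  have hdist : ∀ u v : α → V, Integrable u ν → Integrable v ν →
      edist (∫ a, inner ℝ (u a) (ψ a) ∂ν) (∫ a, inner ℝ (v a) (ψ a) ∂ν) ≤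
        (∫⁻ a, ‖u a - v a‖ₑ ∂ν) * ENNReal.ofReal b := fun u v hu hv => by
    rw [edist_eq_enorm_sub, ← integral_sub (hinner u hu) (hinner v hv)]
    refine (enorm_integral_le_lintegral_enorm _).trans ?_
    have hm : AEMeasurable (fun a => ‖u a - v a‖ₑ) ν := (hu.1.sub hv.1).enorm
    rw [← lintegral_mul_const'' _ hm]
    refine lintegral_mono fun a => ?_
    rw [← inner_sub_left, ← ofReal_norm, ← ofReal_norm, ← ENNReal.ofReal_mul (norm_nonneg _)]
    exact ENNReal.ofReal_le_ofReal ((norm_inner_le_norm _ _).trans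
      (mul_le_mul_of_nonneg_left (hb a) (norm_nonneg _)))
  have htr : ∀ n (k : ℕ), Integrable (fun a => truncVec (k : ℝ) (g n a)) ν := fun n k =>
    memLp_one_iff_integrable.1 (memLp_truncVec (hg n) k 1)
  have hgint : ∀ n, Integrable (g n) ν := fun n => by
    have h1 : Integrable (fun a => g n a - truncVec ((m₁ 0 : ℕ) : ℝ) (g n a)) ν :=
      ⟨(hg n).sub (htr n _).1, ((hUI n _).trans_lt ((hm₁ 0).trans (by simp)) )⟩
    exact (h1.add (htr n (m₁ 0))).congr (Eventually.of_forall fun a => by simp)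
  have hU : TendstoUniformly
      (fun k n => ∫ a, inner ℝ (truncVec ((m₁ k : ℕ) : ℝ) (g n a)) (ψ a) ∂ν)
      (fun n => ∫ a, inner ℝ (g n a) (ψ a) ∂ν) atTop := by
    rw [EMetric.tendstoUniformly_iff]
    intro ε hε
    have h0 : Tendsto (fun k => δ (m₁ k) * ENNReal.ofReal b) atTop (𝓝 0) := by
      simpa using ENNReal.Tendsto.mul_const hδm (Or.inr ENNReal.ofReal_ne_top)
    filter_upwards [h0.eventually_lt_const hε] with k hk n
    exact ((hdist _ _ (hgint n) (htr n _)).trans (mul_le_mul_left (hUI n _) _)).trans_lt hk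
  refine hU.tendsto_of_eventually_tendsto (L := fun k => ∫ a, inner ℝ (W (m₁ k) a) (ψ a) ∂ν)
    (Eventually.of_forall fun k => ?_) ?_
  · have hψ2 : MemLp ψ 2 ν := MemLp.of_bound hψ b (Eventually.of_forall hb)
    have := hW (m₁ k) hψ2.toLp
    simp only [L2.inner_def] at this
    refine Tendsto.congr (fun n => integral_congr_ae ?_) (this.trans (le_of_eq ?_))
    · filter_upwards [hψ2.coeFn_toLp, (memLp_truncVec (hg n) (m₁ k) 2).coeFn_toLp] with a h1 h2
      rw [h1, h2]
    · congr 1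
      refine integral_congr_ae ?_
      filter_upwards [hψ2.coeFn_toLp] with a h1
      rw [h1]
  · have hlim' : Tendsto (fun k => eLpNorm ((W (m₁ k) : α → V) - G) 1 ν * ENNReal.ofReal b) atTop
        (𝓝 0) := by
      simpa using ENNReal.Tendsto.mul_const hlim (Or.inr ENNReal.ofReal_ne_top)
    rw [tendsto_iff_edist_tendsto_0]
    refine tendsto_of_tendsto_of_tendsto_of_le_of_le tendsto_const_nhds hlim'
      (fun _ => zero_le) fun k => ?_
    rw [eLpNorm_one_eq_lintegral_enorm]
    exact hdist _ _ (memLp_one_iff_integrable.1 (hW1 _)) hGint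

end DunfordPettis

/-- Lower semicontinuity of convex integral functionals along weak limits, with integrands
converging uniformly on bounded sets. -/
theorem exists_weak_limit_lowerSemicontinuous {α V : Type*} [MeasurableSpace α]
    [NormedAddCommGroup V] [InnerProductSpace ℝ V]
    [CompleteSpace V] [MeasurableSpace V] [BorelSpace V] [SecondCountableTopology V]
    {ν : Measure α} [IsFiniteMeasure ν]
    {g : ℕ → α → V} (hg : ∀ n, AEStronglyMeasurable (g n) ν)
    {δ : ℕ → ℝ≥0∞} (hδ : Tendsto δ atTop (𝓝 0))
    (hUI : ∀ n (k : ℕ), ∫⁻ a, ‖g n a - truncVec k (g n a)‖ₑ ∂ν ≤ δ k) :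
    ∃ (G : α → V) (l : Filter ℕ), Integrable G ν ∧ l ≤ atTop ∧ l.NeBot ∧
      (∀ ψ : α → V, AEStronglyMeasurable ψ ν → ∀ b : ℝ, (∀ a, ‖ψ a‖ ≤ b) →
        Tendsto (fun n => ∫ a, inner ℝ (g n a) (ψ a) ∂ν) l
          (𝓝 (∫ a, inner ℝ (G a) (ψ a) ∂ν))) ∧
      ∀ (ν' : Measure α) (f : ℕ → α → V → ℝ) (f' : α → V → ℝ) (c : ℝ≥0∞),
        IsFiniteMeasure ν' → ν' ≪ ν →
        (∀ u : α → V, AEStronglyMeasurable u ν → AEMeasurable (fun a => f' a (u a)) ν') →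
        (∀ n, ∀ u : α → V, AEStronglyMeasurable u ν → AEMeasurable (fun a => f n a (u a)) ν') →
        (∀ᵐ a ∂ν', Continuous (f' a)) → (∀ᵐ a ∂ν', ConvexOn ℝ univ (f' a)) →
        (∀ᵐ a ∂ν', ∀ v, 0 ≤ f' a v) → (∀ᵐ a ∂ν', ∀ n v, 0 ≤ f n a v) →
        (∀ᵐ a ∂ν', ∀ n, f n a 0 ≤ 0) →
        (∀ M : ℝ, ∃ b : ℝ, ∀ᵐ a ∂ν', ∀ v, ‖v‖ ≤ M → f' a v ≤ b ∧ ∀ n, f n a v ≤ b) →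
        (∀ᵐ a ∂ν', ∀ (p : ℕ → V) (M : ℝ), (∀ n, ‖p n‖ ≤ M) →
          Tendsto (fun n => f' a (p n) - f n a (p n)) atTop (𝓝 0)) →
        (∀ᶠ n in l, ∫⁻ a, ENNReal.ofReal (f n a (g n a)) ∂ν' ≤ c) →
        ∫⁻ a, ENNReal.ofReal (f' a (G a)) ∂ν' ≤ c := by
  obtain ⟨G, m, w, hG, hw, hae, hψ⟩ :=
    exists_weak_limit_of_uniformIntegrable (Ultrafilter.of atTop) hg hδ hUI
  refine ⟨G, (Ultrafilter.of atTop : Ultrafilter ℕ), hG, Ultrafilter.of_le _, inferInstance, hψ, ?_⟩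
  intro ν' f f' c hfin hac hmeas' hmeas hcont hconv hnn' hnn h0 hb hlim hle
  have hle' : ∀ k, ∀ ε > 0, ∫⁻ a, ENNReal.ofReal (f' a (w k a)) ∂ν' ≤ c + ε := fun k ε hε => by
    refine mem_of_weak_limit (hw k) (isClosed_sublevel_convexIntegral hac hmeas' hcont (c + ε))
      (convex_sublevel_convexIntegral hac hmeas' hconv hnn' (c + ε)) ?_
    obtain ⟨b, hb⟩ := hb (m k)
    have htm : ∀ n, AEStronglyMeasurable (fun a => truncVec (m k : ℝ) (g n a)) ν := fun n =>
      aestronglyMeasurable_truncVec (hg n) _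
    have herr : Tendsto (fun n => ∫⁻ a, ENNReal.ofReal (f' a (truncVec (m k) (g n a)) -
        f n a (truncVec (m k) (g n a))) ∂ν') atTop (𝓝 0) := by
      rw [← lintegral_zero (μ := ν')]
      refine tendsto_lintegral_of_dominated_convergence' (fun _ => ENNReal.ofReal b)
        (fun n => ((hmeas' _ (htm n)).sub (hmeas n _ (htm n))).ennreal_ofReal) (fun n => ?_)
        (by simp [ENNReal.mul_eq_top]) ?_
      · filter_upwards [hb, hnn] with a h1 h2
        refine ENNReal.ofReal_le_ofReal ?_
        have := (h1 _ (norm_truncVec_le (Nat.cast_nonneg (m k)) (g n a))).1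
        linarith [h2 n (truncVec (m k) (g n a))]
      · filter_upwards [hlim] with a h1
        have := h1 (fun n => truncVec (m k) (g n a)) (m k)
          fun n => norm_truncVec_le (Nat.cast_nonneg _) _
        simpa [Function.comp_def] using (ENNReal.continuous_ofReal.tendsto 0).comp this
    filter_upwards [hle, (Ultrafilter.of_le (atTop : Filter ℕ)) (herr.eventually_le_const hε)]
      with n h1 h2
    calc ∫⁻ a, ENNReal.ofReal (f' a (((memLp_truncVec (hg n) (m k) 2).toLp _ : Lp V 2 ν) a)) ∂ν'
        ≤ ∫⁻ a, (ENNReal.ofReal (f n a (g n a)) + ENNReal.ofReal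
            (f' a (truncVec (m k) (g n a)) - f n a (truncVec (m k) (g n a)))) ∂ν' := by
          refine lintegral_mono_ae ?_
          filter_upwards [hac.ae_le (memLp_truncVec (hg n) (m k) 2).coeFn_toLp, h0, hnn]
            with a ha hz hn
          rw [ha]
          refine (ENNReal.ofReal_le_ofReal (le_of_eq (add_sub_cancel (f n a (truncVec (m k)
            (g n a))) _).symm)).trans (ENNReal.ofReal_add_le.trans ?_)
          gcongr
          rcases truncVec_eq_or (m k : ℝ) (g n a) with h | h <;> rw [h]
          exact (hz n).trans (hn n _)
      _ = _ := lintegral_add_left' (hmeas n _ (hg n)).ennreal_ofReal _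
      _ ≤ c + ε := add_le_add h1 h2
  calc ∫⁻ a, ENNReal.ofReal (f' a (G a)) ∂ν'
      = ∫⁻ a, liminf (fun k => ENNReal.ofReal (f' a (w k a))) atTop ∂ν' := by
        refine lintegral_congr_ae ?_
        filter_upwards [hac.ae_le hae, hcont] with a ha hc
        exact ((ENNReal.continuous_ofReal.tendsto _).comp
          ((hc.tendsto _).comp ha)).liminf_eq.symm
    _ ≤ liminf (fun k => ∫⁻ a, ENNReal.ofReal (f' a (w k a)) ∂ν') atTop :=
        lintegral_liminf_le' fun k => (hmeas' _ (Lp.aestronglyMeasurable _)).ennreal_ofReal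
    _ ≤ c := by
        refine (liminf_le_liminf (v := fun _ => c) (Eventually.of_forall fun k =>
          ENNReal.le_of_forall_pos_le_add fun ε hε _ => hle' k ε (by exact_mod_cast hε))).trans ?_
        simp

theorem tendsto_sub_of_continuousOn {V : Type*} [NormedAddCommGroup V] [ProperSpace V]
    {K : Set V} {F : V × V → ℝ}
    (hF : ContinuousOn F (K ×ˢ univ)) {x : ℕ → V} {x' : V} (hx : ∀ n, x n ∈ K) (hx' : x' ∈ K)
    (hlim : Tendsto x atTop (𝓝 x')) {p : ℕ → V} {M : ℝ} (hp : ∀ n, ‖p n‖ ≤ M) :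
    Tendsto (fun n => F (x', p n) - F (x n, p n)) atTop (𝓝 0) := by
  have hcpt : IsCompact (insert x' (range x) ×ˢ Metric.closedBall (0 : V) M) :=
    hlim.isCompact_insert_range.prod (isCompact_closedBall _ _)
  have huc := hcpt.uniformContinuousOn_of_continuous (hF.mono (by
    refine prod_mono (insert_subset hx' ?_) (subset_univ _)
    rintro _ ⟨n, rfl⟩; exact hx n))
  rw [Metric.uniformContinuousOn_iff] at huc
  rw [Metric.tendsto_atTop]
  intro ε hε
  obtain ⟨δ, hδ, h⟩ := huc ε hε
  obtain ⟨N, hN⟩ := Metric.tendsto_atTop.1 hlim δ hδ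
  refine ⟨N, fun n hn => ?_⟩
  have := h (x', p n) ⟨mem_insert _ _, by simpa using hp n⟩ (x n, p n)
    ⟨mem_insert_of_mem _ (mem_range_self n), by simpa using hp n⟩ (by
      simpa [Prod.dist_eq, dist_comm, hδ] using hN n hn)
  rw [Real.dist_eq] at this ⊢
  simpa using this

theorem lintegral_enorm_sub_truncVec_le {α V : Type*} [MeasurableSpace α]
    [NormedAddCommGroup V] {ν : Measure α}
    {θ : ℝ} (hθ : 1 < θ) (g : α → V) {R : ℝ≥0∞} (hR : ∫⁻ a, ‖g a‖ₑ ^ θ ∂ν ≤ R) (k : ℕ) :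
    ∫⁻ a, ‖g a - truncVec k (g a)‖ₑ ∂ν ≤ (k : ℝ≥0∞) ^ (1 - θ) * (R + 1) := by
  rcases Nat.eq_zero_or_pos k with rfl | hk
  · rw [CharP.cast_eq_zero (R := ℝ≥0∞), ENNReal.zero_rpow_of_neg (by linarith),
      ENNReal.top_mul (by simp)]
    exact le_top
  have hk0 : (k : ℝ≥0∞) ^ (1 - θ) ≠ ⊤ := by
    refine ENNReal.rpow_ne_top_of_ne_zero (by exact_mod_cast hk.ne') (by simp)
  calc ∫⁻ a, ‖g a - truncVec k (g a)‖ₑ ∂ν ≤ ∫⁻ a, (k : ℝ≥0∞) ^ (1 - θ) * ‖g a‖ₑ ^ θ ∂ν := by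
        refine lintegral_mono fun a => ?_
        unfold truncVec
        split_ifs with h
        · simp
        · rw [sub_zero]
          have hne : ‖g a‖ₑ ≠ 0 := by
            rw [enorm_ne_zero]
            rintro h0; rw [h0, norm_zero] at h; exact h (Nat.cast_nonneg k)
          have hle : (k : ℝ≥0∞) ≤ ‖g a‖ₑ := by
            rw [← ofReal_norm, ← ENNReal.ofReal_natCast]
            exact ENNReal.ofReal_le_ofReal (not_le.1 h).le
          calc ‖g a‖ₑ = ‖g a‖ₑ ^ (1 - θ) * ‖g a‖ₑ ^ θ := by
                rw [← ENNReal.rpow_add _ _ hne (by simp)]; simp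
            _ ≤ _ := by
              gcongr ?_ * _
              rw [← neg_sub, ENNReal.rpow_neg, ENNReal.rpow_neg, ENNReal.inv_le_inv]
              exact ENNReal.rpow_le_rpow hle (by linarith)
    _ = (k : ℝ≥0∞) ^ (1 - θ) * ∫⁻ a, ‖g a‖ₑ ^ θ ∂ν := lintegral_const_mul' _ _ hk0
    _ ≤ _ := by gcongr; exact hR.trans le_self_add

section Tonelli
variable {V : Type*} [NormedAddCommGroup V] [InnerProductSpace ℝ V]

/-- Nonnegative Carathéodory integrands, convex in the velocity. -/
structure TonelliIntegrand (K : Set V) (f : ℝ → V → V → ℝ) : Prop where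
  meas : ∀ x p, Measurable fun t => f t x p
  cont : ∀ᵐ t ∂volume.restrict (Ioi (0 : ℝ)),
    ContinuousOn (fun q : V × V => f t q.1 q.2) (K ×ˢ univ)
  conv : ∀ᵐ t ∂volume.restrict (Ioi (0 : ℝ)), ∀ x ∈ K, ConvexOn ℝ univ (f t x)
  nonneg : ∀ t, 0 ≤ t → ∀ x ∈ K, ∀ p, 0 ≤ f t x p
  bdd : ∀ M : ℝ, ∃ b : ℝ, ∀ t, 0 ≤ t → ∀ x ∈ K, ∀ p, ‖p‖ ≤ M → f t x p ≤ b
  zero : ∀ t, 0 ≤ t → ∀ x ∈ K, f t x 0 ≤ 0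

theorem TonelliIntegrand.aemeasurable [MeasurableSpace V] [BorelSpace V]
    [SecondCountableTopology V] {K : Set V} {f : ℝ → V → V → ℝ} (hf : TonelliIntegrand K f)
    {z u : ℝ → V} (hz : Continuous z) (hzK : ∀ t, z t ∈ K)
    (hu : AEMeasurable u (volume.restrict (Ioi (0 : ℝ)))) :
    AEMeasurable (fun t => f t (z t) (u t)) (volume.restrict (Ioi (0 : ℝ))) := by
  obtain ⟨S, hS, hSm, hSc⟩ : ∃ S ∈ ae (volume.restrict (Ioi (0 : ℝ))), MeasurableSet S ∧ ∀ t ∈ S,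
      ContinuousOn (fun q : V × V => f t q.1 q.2) (K ×ˢ univ) := by
    obtain ⟨S, hS, hSm, hSc⟩ := IsMeasurablyGenerated.exists_measurable_subset hf.cont
    exact ⟨S, hS, hSm, fun t ht => hSc ht⟩
  classical
  have hm : Measurable (Function.uncurry
      fun (q : K × V) (t : ℝ) => if t ∈ S then f t q.1 q.2 else 0) := by
    refine measurable_uncurry_of_continuous_of_measurable (fun t => ?_) fun q => ?_
    · by_cases ht : t ∈ S
      · simp only [ht, if_true]
        exact (hSc t ht).comp_continuous (f := fun q : K × V => ((q.1 : V), q.2))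
          (by fun_prop) fun q => ⟨q.1.2, mem_univ _⟩
      · simp only [ht, if_false]
        exact continuous_const
    · exact (hf.meas _ _).ite hSm measurable_const
  have h1 : AEMeasurable (fun t => (((⟨z t, hzK t⟩ : K), u t), t))
      (volume.restrict (Ioi (0 : ℝ))) :=
    (((hz.subtype_mk hzK).measurable.aemeasurable).prodMk hu).prodMk aemeasurable_id'
  refine (hm.comp_aemeasurable h1).congr ?_
  filter_upwards [hS] with t ht
  simp [Function.uncurry, ht]

theorem tendsto_nat_rpow_mul_zero {θ : ℝ} (hθ : 1 < θ) {R : ℝ≥0∞} (hR : R ≠ ⊤) :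
    Tendsto (fun k : ℕ => (k : ℝ≥0∞) ^ (1 - θ) * R) atTop (𝓝 0) := by
  have := ((ENNReal.continuous_rpow_const (y := 1 - θ)).tendsto ⊤).comp
    ENNReal.tendsto_nat_nhds_top
  rw [ENNReal.top_rpow_of_neg (by linarith)] at this
  simpa [Function.comp_def] using ENNReal.Tendsto.mul_const this (Or.inr hR)
end Tonelli

section Velocity
variable {V : Type*} [NormedAddCommGroup V] [InnerProductSpace ℝ V]

/-- `g` is a locally integrable velocity of the path `z` on `[0, ∞)`. -/
def IsVel (z g : ℝ → V) : Prop :=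
  (∀ T : ℝ, IntegrableOn g (Icc 0 T) volume) ∧
    ∀ t, 0 ≤ t → z t = z 0 + ∫ s in Ioc 0 t, g s

theorem IsVel.aestronglyMeasurable {z g : ℝ → V} (h : IsVel z g) :
    AEStronglyMeasurable g (volume.restrict (Ioi (0 : ℝ))) := by
  have : AEStronglyMeasurable g (volume.restrict (⋃ n : ℕ, Icc (0 : ℝ) n)) :=
    aestronglyMeasurable_iUnion_iff.2 fun n => (h.1 n).aestronglyMeasurable
  refine this.mono_measure (Measure.restrict_mono (fun t ht => ?_) le_rfl)
  obtain ⟨n, hn⟩ := exists_nat_ge t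
  exact mem_iUnion.2 ⟨n, le_of_lt ht, hn⟩

/-- The measure with density `exp (-t)` on the half-line. -/
def expMeasure : Measure ℝ :=
  (volume.restrict (Ioi (0 : ℝ))).withDensity fun t => ((Real.exp (-t)).toNNReal : ℝ≥0∞)

theorem measurable_exp_neg_toNNReal : Measurable fun t : ℝ => (Real.exp (-t)).toNNReal := by
  fun_prop

instance : IsFiniteMeasure expMeasure :=
  isFiniteMeasure_withDensity_ofReal (integrableOn_exp_neg_Ioi 0).2

theorem expMeasure_ac : expMeasure ≪ volume.restrict (Ioi (0 : ℝ)) :=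
  withDensity_absolutelyContinuous _ _

theorem ac_expMeasure : volume.restrict (Ioi (0 : ℝ)) ≪ expMeasure :=
  withDensity_absolutelyContinuous' measurable_exp_neg_toNNReal.coe_nnreal_ennreal.aemeasurable
    (Eventually.of_forall fun t => by simp [Real.exp_pos])

theorem lintegral_expMeasure_le (F : ℝ → ℝ≥0∞) :
    ∫⁻ t, F t ∂expMeasure ≤ ∫⁻ t in Ioi (0 : ℝ), F t := by
  refine lintegral_mono' ?_ le_rfl
  conv_rhs => rw [← withDensity_one (μ := volume.restrict (Ioi (0 : ℝ)))]
  refine withDensity_mono ?_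
  filter_upwards [ae_restrict_mem measurableSet_Ioi] with t ht
  have : Real.exp (-t) ≤ 1 := Real.exp_le_one_iff.2 (by simpa using le_of_lt ht)
  simpa using this

theorem integrableOn_of_integrable_expMeasure {G : ℝ → V} (hG : Integrable G expMeasure) (T : ℝ) :
    IntegrableOn G (Icc 0 T) volume := by
  have h1 := (integrable_withDensity_iff_integrable_smul measurable_exp_neg_toNNReal).1 hG
  have h2 : IntegrableOn (fun t => (Real.exp (-t)).toNNReal • G t) (Icc 0 T) volume := by
    rw [integrableOn_Icc_iff_integrableOn_Ioc]
    exact IntegrableOn.mono_set (s := Ioc 0 T) h1 Ioc_subset_Ioi_self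
  have h3 := h2.continuousOn_smul (f := Real.exp) Real.continuous_exp.continuousOn
    isCompact_Icc
  refine h3.congr_fun (fun t _ => ?_) measurableSet_Icc
  simp only [NNReal.smul_def, Real.coe_toNNReal _ (Real.exp_pos _).le, smul_smul, ← Real.exp_add]
  simp

theorem integral_inner_expMeasure [CompleteSpace V] {G : ℝ → V} {t : ℝ}
    (hG : IntegrableOn G (Icc 0 t) volume) (e : V) :
    ∫ s, inner ℝ (G s) ((Ioc 0 t).indicator (fun s => Real.exp s • e) s) ∂expMeasure =
      inner ℝ (∫ s in Ioc 0 t, G s) e := by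
  unfold expMeasure
  rw [integral_withDensity_eq_integral_smul measurable_exp_neg_toNNReal, real_inner_comm,
    ← integral_inner (hG.mono_set Ioc_subset_Icc_self)]
  have : ∀ s, (Real.exp (-s)).toNNReal • inner ℝ (G s)
      ((Ioc 0 t).indicator (fun s => Real.exp s • e) s) =
      (Ioc 0 t).indicator (fun s => inner ℝ e (G s)) s := fun s => by
    by_cases hs : s ∈ Ioc 0 t
    · simp only [indicator_of_mem hs, NNReal.smul_def, Real.coe_toNNReal _ (Real.exp_pos _).le,
        inner_smul_right, smul_eq_mul, ← mul_assoc, ← Real.exp_add]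
      simp [real_inner_comm]
    · simp [indicator_of_notMem hs]
  simp_rw [this]
  rw [setIntegral_indicator measurableSet_Ioc, inter_eq_right.2 Ioc_subset_Ioi_self]

theorem exists_weak_velocity [FiniteDimensional ℝ V] [MeasurableSpace V] [BorelSpace V]
    {K : Set V} {θ : ℝ} (hθ : 1 < θ) {z : ℕ → ℝ → V} {z' : ℝ → V} {g : ℕ → ℝ → V}
    (hz : ∀ n, Continuous (z n)) (hzK : ∀ n t, z n t ∈ K) (hz' : Continuous z')
    (hzK' : ∀ t, z' t ∈ K) (hlim : ∀ t, Tendsto (fun n => z n t) atTop (𝓝 (z' t)))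
    (hg : ∀ n, IsVel (z n) (g n)) {R : ℝ≥0∞} (hR : R ≠ ⊤)
    (hgR : ∀ n, ∫⁻ t in Ioi (0 : ℝ), ‖g n t‖ₑ ^ θ ≤ R) :
    ∃ (G : ℝ → V) (l : Filter ℕ), l ≤ atTop ∧ l.NeBot ∧ IsVel z' G ∧
      ∀ f : ℝ → V → V → ℝ, TonelliIntegrand K f → ∀ (T : ℝ) (c : ℝ≥0∞),
        (∀ᶠ n in l, ∫⁻ t in Ioc 0 T, ENNReal.ofReal (f t (z n t) (g n t)) ≤ c) →
        ∫⁻ t in Ioc 0 T, ENNReal.ofReal (f t (z' t) (G t)) ≤ c := by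
  have : ProperSpace V := FiniteDimensional.proper_real V
  have : CompleteSpace V := FiniteDimensional.complete ℝ V
  obtain ⟨G, l, hG, hl, hlne, hψ, hlsc⟩ := exists_weak_limit_lowerSemicontinuous (ν := expMeasure)
    (g := g) (fun n => (hg n).aestronglyMeasurable.mono_ac expMeasure_ac)
    (tendsto_nat_rpow_mul_zero hθ (R := R + 1) (by simp [hR]))
    (fun n k => lintegral_enorm_sub_truncVec_le hθ (g n)
      ((lintegral_expMeasure_le _).trans (hgR n)) k)
  have hGi := integrableOn_of_integrable_expMeasure hG
  refine ⟨G, l, hl, hlne, ⟨hGi, fun t ht => ?_⟩, fun f hf T c hle => ?_⟩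
  · rw [← sub_eq_iff_eq_add']
    refine ext_inner_right ℝ fun e => ?_
    have h1 := hψ ((Ioc 0 t).indicator fun s => Real.exp s • e)
      ((by fun_prop : Continuous fun s : ℝ => Real.exp s • e).aestronglyMeasurable.indicator
        measurableSet_Ioc) (Real.exp t * ‖e‖) (fun s => by
          by_cases hs : s ∈ Ioc 0 t
          · rw [indicator_of_mem hs, norm_smul, Real.norm_eq_abs, abs_of_pos (Real.exp_pos _)]
            gcongr
            exact hs.2
          · rw [indicator_of_notMem hs, norm_zero]; positivity)
    rw [integral_inner_expMeasure (hGi t)] at h1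
    have h2 : Tendsto (fun n => inner ℝ (z n t - z n 0) e) l (𝓝 (inner ℝ (z' t - z' 0) e)) :=
      (((hlim t).sub (hlim 0)).mono_left hl).inner tendsto_const_nhds
    refine tendsto_nhds_unique h2 (h1.congr fun n => ?_)
    rw [integral_inner_expMeasure ((hg n).1 t), (hg n).2 t ht, add_sub_cancel_left]
  · have hrl : volume.restrict (Ioc 0 T) ≤ volume.restrict (Ioi (0 : ℝ)) :=
      Measure.restrict_mono Ioc_subset_Ioi_self le_rfl
    have hac : volume.restrict (Ioc 0 T) ≪ volume.restrict (Ioi (0 : ℝ)) :=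
      Measure.absolutelyContinuous_of_le hrl
    have hpos : ∀ᵐ t ∂volume.restrict (Ioc 0 T), (0 : ℝ) ≤ t := by
      filter_upwards [ae_restrict_mem measurableSet_Ioc] with t ht using ht.1.le
    have hco : ∀ x ∈ K, ∀ t, ContinuousOn (fun q : V × V => f t q.1 q.2) (K ×ˢ univ) →
        Continuous (f t x) := fun x hx t h =>
      h.comp_continuous (f := fun v : V => (x, v)) (by fun_prop) fun v => ⟨hx, mem_univ _⟩
    refine hlsc (volume.restrict (Ioc 0 T)) (fun n t => f t (z n t)) (fun t => f t (z' t)) c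
      inferInstance (hac.trans ac_expMeasure)
      (fun u hu => (hf.aemeasurable hz' hzK' (hu.mono_ac ac_expMeasure).aemeasurable).mono_measure
        hrl)
      (fun n u hu => (hf.aemeasurable (hz n) (hzK n)
        (hu.mono_ac ac_expMeasure).aemeasurable).mono_measure hrl) ?_ ?_ ?_ ?_ ?_ ?_ ?_ hle
    · filter_upwards [hac.ae_le hf.cont] with t ht using hco _ (hzK' t) t ht
    · filter_upwards [hac.ae_le hf.conv] with t ht using ht _ (hzK' t)
    · filter_upwards [hpos] with t ht using hf.nonneg t ht _ (hzK' t)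
    · filter_upwards [hpos] with t ht using fun n => hf.nonneg t ht _ (hzK n t)
    · filter_upwards [hpos] with t ht using fun n => hf.zero t ht _ (hzK n t)
    · intro M
      obtain ⟨b, hb⟩ := hf.bdd M
      refine ⟨b, ?_⟩
      filter_upwards [hpos] with t ht v hv using
        ⟨hb t ht _ (hzK' t) v hv, fun n => hb t ht _ (hzK n t) v hv⟩
    · filter_upwards [hac.ae_le hf.cont] with t ht p M hp using
        tendsto_sub_of_continuousOn ht (hzK · t) (hzK' t) (hlim t) hp
end Velocity

section Paths
variable {V : Type*} [NormedAddCommGroup V] [InnerProductSpace ℝ V]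

/-- `g` is a locally integrable velocity of the path `z` on `[σ, ∞)`. -/
def IsVelFrom (σ : ℝ) (z g : ℝ → V) : Prop :=
  (∀ T : ℝ, IntegrableOn g (Icc σ T) volume) ∧
    ∀ t, σ ≤ t → z t = z σ + ∫ s in Ioc σ t, g s

theorem setIntegral_Ioc_add {g : ℝ → V} {a b c : ℝ} (hab : a ≤ b) (hbc : b ≤ c)
    (hg : IntegrableOn g (Icc a c) volume) :
    ∫ s in Ioc a c, g s = (∫ s in Ioc a b, g s) + ∫ s in Ioc b c, g s := by
  rw [← Ioc_union_Ioc_eq_Ioc hab hbc]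
  exact setIntegral_union (Ioc_disjoint_Ioc_of_le le_rfl) measurableSet_Ioc
    (hg.mono_set (Ioc_subset_Icc_self.trans (Icc_subset_Icc le_rfl hbc)))
    (hg.mono_set (Ioc_subset_Icc_self.trans (Icc_subset_Icc hab le_rfl)))

theorem IsVel.isVelFrom {z g : ℝ → V} (h : IsVel z g) {σ : ℝ} (hσ : 0 ≤ σ) :
    IsVelFrom σ z g := by
  refine ⟨fun T => (h.1 T).mono_set (Icc_subset_Icc hσ le_rfl), fun t ht => ?_⟩
  rw [h.2 t (hσ.trans ht), h.2 σ hσ, setIntegral_Ioc_add hσ ht (h.1 t), add_assoc]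

open Classical in
theorem IsVel.concat {z₁ g₁ z₂ g₂ : ℝ → V} {σ : ℝ} (h₁ : IsVel z₁ g₁) (hσ : 0 ≤ σ)
    (h₂ : IsVelFrom σ z₂ g₂) (h : z₁ σ = z₂ σ) :
    IsVel ((Iic σ).piecewise z₁ z₂) ((Iic σ).piecewise g₁ g₂) := by
  have hi : ∀ T, IntegrableOn ((Iic σ).piecewise g₁ g₂) (Icc 0 T) volume := fun T => by
    have h3 : IntegrableOn ((Iic σ).piecewise g₁ g₂) (Icc 0 T ∩ Iic σ) volume :=
      ((h₁.1 T).mono_set inter_subset_left).congr_fun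
        (fun t ht => (piecewise_eq_of_mem _ _ _ ht.2).symm) (by measurability)
    have h4 : IntegrableOn ((Iic σ).piecewise g₁ g₂) (Icc 0 T ∩ Ioi σ) volume :=
      ((h₂.1 T).mono_set (fun t ht => ⟨le_of_lt ht.2, ht.1.2⟩)).congr_fun
        (fun t ht => (piecewise_eq_of_notMem (Iic σ) _ _
          (show ¬ t ≤ σ from not_le.2 ht.2)).symm) (by measurability)
    refine (h3.union h4).mono_set fun t ht => ?_
    rcases le_or_gt t σ with h | h
    · exact Or.inl ⟨ht, h⟩
    · exact Or.inr ⟨ht, h⟩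
  refine ⟨hi, fun t ht => ?_⟩
  have hle : ∀ s, s ≤ σ →
      ∫ r in Ioc 0 s, (Iic σ).piecewise g₁ g₂ r = ∫ r in Ioc 0 s, g₁ r := fun s hs =>
    setIntegral_congr_fun measurableSet_Ioc fun r hr =>
      piecewise_eq_of_mem (Iic σ) _ _ (hr.2.trans hs)
  rw [piecewise_eq_of_mem (Iic σ) _ _ hσ]
  rcases le_or_gt t σ with h' | h'
  · rw [piecewise_eq_of_mem (Iic σ) _ _ h', hle t h', h₁.2 t ht]
  · rw [piecewise_eq_of_notMem (Iic σ) _ _ (not_le.2 h'), setIntegral_Ioc_add hσ h'.le (hi t),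
      hle σ le_rfl, ← add_assoc, ← h₁.2 σ hσ, h, h₂.2 t h'.le]
    congr 1
    exact setIntegral_congr_fun measurableSet_Ioc fun r hr =>
      (piecewise_eq_of_notMem (Iic σ) _ _ (not_le.2 hr.1)).symm

theorem IsVel.comp_two_mul_sub {z g : ℝ → V} (h : IsVel z g) (d : ℝ) :
    IsVelFrom d (fun t => z (2 * t - 2 * d)) fun t => (2 : ℝ) • g (2 * t - 2 * d) := by
  refine ⟨fun T => ?_, fun t ht => ?_⟩
  · rcases lt_or_ge T d with hT | hT
    · simp [Icc_eq_empty (not_le.2 hT)]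
    have h1 : IntervalIntegrable g volume 0 (2 * T - 2 * d) := by
      rw [intervalIntegrable_iff_integrableOn_Icc_of_le (by linarith)]
      exact h.1 _
    have h2 := (h1.comp_sub_right (2 * d)).comp_mul_left (c := (2 : ℝ))
    rw [show (0 + 2 * d) / 2 = d by ring, show (2 * T - 2 * d + 2 * d) / 2 = T by ring,
      intervalIntegrable_iff_integrableOn_Icc_of_le hT] at h2
    exact h2.smul (2 : ℝ)
  · rw [← intervalIntegral.integral_of_le ht, intervalIntegral.integral_smul,
      intervalIntegral.smul_integral_comp_mul_sub, intervalIntegral.integral_of_le (by linarith),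
      sub_self]
    simpa using h.2 (2 * t - 2 * d) (by linarith)

theorem LipschitzWith.isVel_deriv [FiniteDimensional ℝ V] {z : ℝ → V} {C : ℝ≥0}
    (hz : LipschitzWith C z) : IsVel z (deriv z) := by
  borelize V
  have : CompleteSpace V := FiniteDimensional.complete ℝ V
  have : ProperSpace V := FiniteDimensional.proper_real V
  have hb : ∀ t, ‖deriv z t‖ ≤ C := fun t => norm_deriv_le_of_lipschitz hz
  have hm : AEStronglyMeasurable (deriv z) volume :=
    (measurable_deriv z).stronglyMeasurable.aestronglyMeasurable
  have hloc : LocallyIntegrable (deriv z) volume := by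
    refine (locallyIntegrable_const (C : ℝ)).mono hm (Eventually.of_forall fun t => ?_)
    simpa using hb t
  refine ⟨fun T => hloc.integrableOn_isCompact isCompact_Icc, fun t ht => ?_⟩
  have hInt : ∀ a b, IntervalIntegrable (deriv z) volume a b := fun a b =>
    (hloc.integrableOn_isCompact isCompact_uIcc).intervalIntegrable
  have hL : LipschitzWith C fun t => ∫ s in (0 : ℝ)..t, deriv z s :=
    LipschitzWith.of_dist_le_mul fun x y => by
      rw [dist_eq_norm, intervalIntegral.integral_interval_sub_left (hInt _ _) (hInt _ _),
        Real.dist_eq]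
      exact intervalIntegral.norm_integral_le_of_norm_le_const fun s _ => hb s
  obtain ⟨c, hc⟩ := AbsolutelyContinuousOnInterval.const_of_ae_hasDerivAt_zero
    (f := fun t => z t - ∫ s in (0 : ℝ)..t, deriv z s) (a := 0) (b := t)
    ((hz.lipschitzOnWith.absolutelyContinuousOnInterval).sub
      hL.lipschitzOnWith.absolutelyContinuousOnInterval) (by
      filter_upwards [LocallyIntegrable.ae_hasDerivAt_integral hloc, hz.ae_differentiableAt]
        with s h1 h2 _
      have h3 := h2.hasDerivAt.sub (h1 0)
      rwa [sub_self] at h3)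
  have h0 := hc 0 left_mem_uIcc
  have h1 := hc t right_mem_uIcc
  rw [← intervalIntegral.integral_of_le ht]
  simp only [intervalIntegral.integral_same, sub_zero] at h0
  rw [h0, ← h1]
  simp

theorem IsVel.ae_hasDerivAt [CompleteSpace V] {z g : ℝ → V} (h : IsVel z g) :
    ∀ᵐ t ∂volume.restrict (Ioi (0 : ℝ)), HasDerivAt z (g t) t := by
  have h1 : ∀ n : ℕ, ∀ᵐ t, t ∈ uIcc (0 : ℝ) n → ∀ c ∈ uIcc (0 : ℝ) n,
      HasDerivAt (fun x => ∫ s in c..x, g s) (g t) t := fun n =>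
    IntervalIntegrable.ae_hasDerivAt_integral (by
      rw [intervalIntegrable_iff_integrableOn_Icc_of_le (Nat.cast_nonneg n)]
      exact h.1 n)
  filter_upwards [ae_restrict_mem measurableSet_Ioi, ae_restrict_of_ae (ae_all_iff.2 h1)]
    with t ht h2
  obtain ⟨n, hn⟩ := exists_nat_ge t
  have h3 := h2 n (by rw [uIcc_of_le (Nat.cast_nonneg n)]; exact ⟨le_of_lt ht, hn⟩) 0
    left_mem_uIcc
  refine (h3.const_add (z 0)).congr_of_eventuallyEq ?_
  filter_upwards [lt_mem_nhds (mem_Ioi.1 ht)] with s hs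
  rw [h.2 s hs.le, intervalIntegral.integral_of_le hs.le]

theorem IsVel.ae_eq [CompleteSpace V] {z g g' : ℝ → V} (h : IsVel z g) (h' : IsVel z g') :
    g =ᵐ[volume.restrict (Ioi (0 : ℝ))] g' := by
  filter_upwards [h.ae_hasDerivAt, h'.ae_hasDerivAt] with t h1 h2 using h1.unique h2
end Paths

theorem setLIntegral_lt_le_of_forall {F : ℝ → ℝ≥0∞} {m c : ℝ≥0∞}
    (h : ∀ T : ℝ, ENNReal.ofReal T < m → ∫⁻ t in Ioc 0 T, F t ≤ c) :
    ∫⁻ t in {t : ℝ | 0 < t ∧ ENNReal.ofReal t < m}, F t ≤ c := by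
  have hset : {t : ℝ | 0 < t ∧ ENNReal.ofReal t < m} ⊆
      ⋃ q : {q : ℚ // ENNReal.ofReal q < m}, Ioc (0 : ℝ) (q : ℚ) := by
    rintro t ⟨h0, hm⟩
    obtain ⟨q, hq0, htq, hqm⟩ := ENNReal.lt_iff_exists_rat_btwn.1 hm
    refine mem_iUnion.2 ⟨⟨q, hqm⟩, h0, ?_⟩
    by_contra hc
    exact absurd htq (not_lt.2 (ENNReal.ofReal_le_ofReal (not_le.1 hc).le))
  refine (lintegral_mono_set hset).trans ?_
  rw [setLIntegral_iUnion_of_directed]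
  · exact iSup_le fun q => h _ q.2
  · exact Monotone.directed_le fun p q hpq => Ioc_subset_Ioc le_rfl (by exact_mod_cast hpq)

theorem setLIntegral_Ioi_le_of_forall {F : ℝ → ℝ≥0∞} {c : ℝ≥0∞}
    (h : ∀ T : ℝ, ∫⁻ t in Ioc 0 T, F t ≤ c) : ∫⁻ t in Ioi (0 : ℝ), F t ≤ c := by
  refine (lintegral_mono_set fun t ht => ?_).trans
    (setLIntegral_lt_le_of_forall (m := ⊤) fun T _ => h T)
  exact ⟨ht, ENNReal.ofReal_lt_top⟩

section Curves
variable {Ω Ξ : Set (EucSp d)} {ℓ : ℝ → EucSp d → EucSp d → ℝ}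
  {h : ℝ → EucSp d → EucSp d → EucSp d → EucSp d → ℝ}

/-- The path on `ℝ` obtained by extending a curve by its initial value to negative times. -/
def CurveSp.path (γ : CurveSp Ω) (t : ℝ) : EucSp d := γ.1 t.toNNReal

theorem CurveSp.continuous_path (γ : CurveSp Ω) : Continuous (CurveSp.path γ) :=
  γ.1.continuous.comp continuous_real_toNNReal

theorem CurveSp.path_mem (γ : CurveSp Ω) (t : ℝ) : CurveSp.path γ t ∈ closure Ω := γ.2 _

theorem CurveSp.tendsto_path {ι : Type*} {l : Filter ι} {u : ι → CurveSp Ω} {γ : CurveSp Ω}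
    (hu : Tendsto u l (𝓝 γ)) (t : ℝ) :
    Tendsto (fun n => CurveSp.path (u n) t) l (𝓝 (CurveSp.path γ t)) :=
  (((continuous_eval_const t.toNNReal).comp continuous_subtype_val).tendsto γ).comp hu

theorem hasVel_iff_isVel {γ : CurveSp Ω} {g : ℝ → EucSp d} :
    HasVel γ g ↔ IsVel (CurveSp.path γ) g := by
  unfold HasVel IsVel CurveSp.path
  refine and_congr_right fun _ => ⟨fun H t ht => ?_, fun H t => ?_⟩
  · simpa [Real.coe_toNNReal t ht] using H t.toNNReal
  · simpa using H t t.2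

theorem HasVel.ae_eq {γ : CurveSp Ω} {g g' : ℝ → EucSp d} (hg : HasVel γ g) (hg' : HasVel γ g') :
    g =ᵐ[volume.restrict (Ioi (0 : ℝ))] g' :=
  (hasVel_iff_isVel.1 hg).ae_eq (hasVel_iff_isVel.1 hg')

theorem HasVel.aemeasurable {γ : CurveSp Ω} {g : ℝ → EucSp d} (hg : HasVel γ g) :
    AEMeasurable g (volume.restrict (Ioi (0 : ℝ))) :=
  (hasVel_iff_isVel.1 hg).aestronglyMeasurable.aemeasurable

/-- The running cost `∫₀^∞ ℓ(t, γ, γ̇) dt`, infinite for curves without velocity. -/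
def actionCost (ℓ : ℝ → EucSp d → EucSp d → ℝ) (γ : CurveSp Ω) : ℝ≥0∞ :=
  ⨅ (g : ℝ → EucSp d) (_ : HasVel γ g),
    ∫⁻ t in Ioi (0 : ℝ), ENNReal.ofReal (ℓ t (γ.1 t.toNNReal) (g t))

theorem Lcost_eq (Ψ : ℝ → ℝ) (γ : CurveSp Ω) :
    Lcost ℓ Ψ Ξ γ = actionCost ℓ γ + PsiExt Ψ (exitT Ξ γ) := rfl

theorem HasVel.actionCost_eq {γ : CurveSp Ω} {g : ℝ → EucSp d} (hg : HasVel γ g) :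
    actionCost ℓ γ = ∫⁻ t in Ioi (0 : ℝ), ENNReal.ofReal (ℓ t (γ.1 t.toNNReal) (g t)) := by
  refine le_antisymm (iInf₂_le g hg) (le_iInf₂ fun g' hg' => (lintegral_congr_ae ?_).le)
  filter_upwards [hg.ae_eq hg'] with t ht
  rw [ht]

theorem exists_hasVel_of_actionCost_ne_top {γ : CurveSp Ω} (hγ : actionCost ℓ γ ≠ ⊤) :
    ∃ g, HasVel γ g := by
  by_contra! hc
  exact hγ (by simp [actionCost, hc])

theorem HasVel.interCost_eq {γ γ' : CurveSp Ω} {g g' : ℝ → EucSp d} (hg : HasVel γ g)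
    (hg' : HasVel γ' g') :
    interCost h Ξ γ γ' =
      ∫⁻ t in {t : ℝ | 0 < t ∧ ENNReal.ofReal t < min (exitT Ξ γ) (exitT Ξ γ')},
        ENNReal.ofReal (h t (γ.1 t.toNNReal) (γ'.1 t.toNNReal) (g t) (g' t)) := by
  refine le_antisymm ?_ ?_
  · exact (iInf₂_le g hg).trans (iInf₂_le g' hg')
  · refine le_iInf₂ fun g₁ hg₁ => le_iInf₂ fun g₁' hg₁' => (lintegral_congr_ae ?_).le
    have hsub : {t : ℝ | 0 < t ∧ ENNReal.ofReal t < min (exitT Ξ γ) (exitT Ξ γ')} ⊆ Ioi 0 :=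
      fun t ht => ht.1
    filter_upwards [ae_restrict_of_ae_restrict_of_subset hsub (hg.ae_eq hg₁),
      ae_restrict_of_ae_restrict_of_subset hsub (hg'.ae_eq hg₁')] with t h1 h2
    rw [h1, h2]

theorem lintegral_rpow_le_actionCost {α θ : ℝ} (hα : 0 < α) (hθ : 0 ≤ θ)
    (hlb : ∀ t ∈ Ici (0 : ℝ), ∀ x ∈ closure Ω, ∀ p, α * ‖p‖ ^ θ ≤ ℓ t x p)
    {γ : CurveSp Ω} {g : ℝ → EucSp d} (hg : HasVel γ g) :
    ∫⁻ t in Ioi (0 : ℝ), ‖g t‖ₑ ^ θ ≤ (ENNReal.ofReal α)⁻¹ * actionCost ℓ γ := by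
  have hα' : ENNReal.ofReal α ≠ 0 := by simpa using hα
  rw [hg.actionCost_eq, ← lintegral_const_mul' _ _ (ENNReal.inv_ne_top.2 hα')]
  refine setLIntegral_mono' measurableSet_Ioi fun t ht => ?_
  rw [← ENNReal.div_eq_inv_mul, ENNReal.le_div_iff_mul_le (Or.inl hα') (Or.inl (by simp)),
    mul_comm, ← ofReal_norm, ENNReal.ofReal_rpow_of_nonneg (norm_nonneg _) hθ,
    ← ENNReal.ofReal_mul hα.le]
  exact ENNReal.ofReal_le_ofReal (hlb t (mem_Ici_of_Ioi ht) _ (γ.2 _) _)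

theorem IsVel.toLp_prod {z z' g g' : ℝ → EucSp d} (hz : IsVel z g) (hz' : IsVel z' g') :
    IsVel (fun t => WithLp.toLp 2 (z t, z' t)) fun t => WithLp.toLp 2 (g t, g' t) := by
  let L := (WithLp.prodContinuousLinearEquiv 2 ℝ (EucSp d) (EucSp d)).symm.toContinuousLinearMap
  have hi : ∀ T, IntegrableOn (fun t => (g t, g' t)) (Icc 0 T) volume := fun T =>
    (hz.1 T).prodMk (hz'.1 T)
  refine ⟨fun T => L.integrable_comp (hi T), fun t ht => ?_⟩
  have h1 := L.integral_comp_comm ((hi t).mono_set Ioc_subset_Icc_self)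
  rw [integral_pair ((hz.1 t).mono_set Ioc_subset_Icc_self)
    ((hz'.1 t).mono_set Ioc_subset_Icc_self)] at h1
  refine Eq.trans ?_ (congrArg _ h1.symm)
  beta_reduce
  rw [hz.2 t ht, hz'.2 t ht]
  rfl

theorem IsVel.clm_comp {E F : Type*} [NormedAddCommGroup E] [InnerProductSpace ℝ E]
    [CompleteSpace E] [NormedAddCommGroup F] [InnerProductSpace ℝ F] [CompleteSpace F]
    (L : E →L[ℝ] F) {z g : ℝ → E} (hz : IsVel z g) :
    IsVel (fun t => L (z t)) fun t => L (g t) := by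
  refine ⟨fun T => L.integrable_comp (hz.1 T), fun t ht => ?_⟩
  rw [L.integral_comp_comm ((hz.1 t).mono_set Ioc_subset_Icc_self)]
  beta_reduce
  rw [hz.2 t ht, map_add]

theorem IsVel.fst {z g : ℝ → WithLp 2 (EucSp d × EucSp d)} (hz : IsVel z g) :
    IsVel (fun t => (z t).fst) fun t => (g t).fst :=
  hz.clm_comp ((ContinuousLinearMap.fst ℝ _ _).comp
    (WithLp.prodContinuousLinearEquiv 2 ℝ (EucSp d) (EucSp d)).toContinuousLinearMap)

theorem IsVel.snd {z g : ℝ → WithLp 2 (EucSp d × EucSp d)} (hz : IsVel z g) :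
    IsVel (fun t => (z t).snd) fun t => (g t).snd :=
  hz.clm_comp ((ContinuousLinearMap.snd ℝ _ _).comp
    (WithLp.prodContinuousLinearEquiv 2 ℝ (EucSp d) (EucSp d)).toContinuousLinearMap)

theorem enorm_toLp_prod_le (p q : EucSp d) : ‖WithLp.toLp 2 (p, q)‖ₑ ≤ ‖p‖ₑ + ‖q‖ₑ := by
  have : WithLp.toLp 2 (p, q) = WithLp.toLp 2 (p, 0) + WithLp.toLp 2 (0, q) := by
    rw [← WithLp.toLp_add]; simp
  rw [this]
  refine (enorm_add_le _ _).trans ?_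
  simp [enorm]

/-- The set of pairs of points of `K`, in the Euclidean product. -/
def pairSet (K : Set (EucSp d)) : Set (WithLp 2 (EucSp d × EucSp d)) :=
  {v | v.fst ∈ K ∧ v.snd ∈ K}

theorem actionCost_le_of_tendsto {α θ : ℝ} (hα : 0 < α) (hθ : 1 < θ)
    (hlb : ∀ t ∈ Ici (0 : ℝ), ∀ x ∈ closure Ω, ∀ p, α * ‖p‖ ^ θ ≤ ℓ t x p)
    (hℓ : TonelliIntegrand (closure Ω) ℓ) {u : ℕ → CurveSp Ω} {γ : CurveSp Ω}
    (hu : Tendsto u atTop (𝓝 γ)) {c : ℝ≥0∞} (hc : c ≠ ⊤) (hle : ∀ n, actionCost ℓ (u n) ≤ c) :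
    actionCost ℓ γ ≤ c := by
  choose g hg using fun n =>
    exists_hasVel_of_actionCost_ne_top (ne_top_of_le_ne_top hc (hle n))
  have hα' : ENNReal.ofReal α ≠ 0 := by simpa using hα
  obtain ⟨G, l, hl, hlne, hG, hlsc⟩ := exists_weak_velocity (K := closure Ω) hθ
    (fun n => CurveSp.continuous_path (u n)) (fun n => CurveSp.path_mem (u n))
    (CurveSp.continuous_path γ) (CurveSp.path_mem γ) (CurveSp.tendsto_path hu)
    (fun n => hasVel_iff_isVel.1 (hg n))
    (R := (ENNReal.ofReal α)⁻¹ * c) (ENNReal.mul_ne_top (ENNReal.inv_ne_top.2 hα') hc)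
    (fun n => (lintegral_rpow_le_actionCost hα (by linarith) hlb (hg n)).trans
      (by gcongr; exact hle n))
  rw [(hasVel_iff_isVel.2 hG).actionCost_eq]
  refine setLIntegral_Ioi_le_of_forall fun T => hlsc ℓ hℓ T c (Eventually.of_forall fun n => ?_)
  refine (lintegral_mono_set Ioc_subset_Ioi_self).trans ?_
  have := hle n
  rwa [(hg n).actionCost_eq] at this

theorem tonelliIntegrand_pair {K : Set (EucSp d)} {C β : ℝ} (hC : 0 < C) (hβ : 0 < β)
    (hhmeas : ∀ x x' p p', Measurable fun t : ℝ => h t x x' p p')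
    (hhcont : ∀ᵐ t ∂(volume.restrict (Ioi (0 : ℝ))),
      ContinuousOn
        (fun q : (EucSp d × EucSp d) × EucSp d × EucSp d => h t q.1.1 q.1.2 q.2.1 q.2.2)
        ((K ×ˢ K) ×ˢ (univ : Set (EucSp d × EucSp d))))
    (hhconv : ∀ᵐ t ∂(volume.restrict (Ioi (0 : ℝ))), ∀ x ∈ K, ∀ x' ∈ K,
      ConvexOn ℝ univ fun q : EucSp d × EucSp d => h t x x' q.1 q.2)
    (hhnn : ∀ t ∈ Ici (0 : ℝ), ∀ x ∈ K, ∀ x' ∈ K, ∀ p p', 0 ≤ h t x x' p p')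
    (hhub : ∀ t ∈ Ici (0 : ℝ), ∀ x ∈ K, ∀ x' ∈ K, ∀ p p',
      h t x x' p p' ≤ C * (‖p‖ ^ β + ‖p'‖ ^ β)) :
    TonelliIntegrand (pairSet K) fun t v w => h t v.fst v.snd w.fst w.snd where
  meas _ _ := hhmeas _ _ _ _
  cont := by
    filter_upwards [hhcont] with t ht
    refine ht.comp (f := fun q : WithLp 2 (EucSp d × EucSp d) × WithLp 2 (EucSp d × EucSp d) =>
      ((q.1.fst, q.1.snd), (q.2.fst, q.2.snd))) (by fun_prop) fun q hq => ⟨hq.1, mem_univ _⟩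
  conv := by
    filter_upwards [hhconv] with t ht x hx
    exact (ht _ hx.1 _ hx.2).comp_linearMap
      (WithLp.linearEquiv 2 ℝ (EucSp d × EucSp d)).toLinearMap
  nonneg t ht x hx p := hhnn t ht _ hx.1 _ hx.2 _ _
  bdd M := by
    refine ⟨C * (|M| ^ β + |M| ^ β), fun t ht x hx p hp => ?_⟩
    refine (hhub t ht _ hx.1 _ hx.2 _ _).trans ?_
    have hp' := hp.trans (le_abs_self M)
    have h1 : ‖p.fst‖ ≤ |M| := (WithLp.norm_fst_le _ p).trans hp'
    have h2 : ‖p.snd‖ ≤ |M| := (WithLp.norm_snd_le _ p).trans hp'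
    gcongr
  zero t ht x hx := by
    refine (hhub t ht _ hx.1 _ hx.2 _ _).trans ?_
    simp [Real.zero_rpow hβ.ne']

theorem lt_exitT_iff (hΞ : IsClosed Ξ) (T : ℝ≥0) (γ : CurveSp Ω) :
    (T : ℝ≥0∞) < exitT Ξ γ ↔ MapsTo γ.1 (Icc 0 T) Ξᶜ := by
  constructor
  · intro hT t ht hm
    have h1 : (T : ℝ≥0∞) < t := lt_of_lt_of_le hT (iInf₂_le t hm)
    exact absurd ht.2 (not_le.2 (by exact_mod_cast h1))
  · intro hm
    have ho : IsOpen (γ.1 ⁻¹' Ξᶜ) := hΞ.isOpen_compl.preimage γ.1.continuous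
    obtain ⟨T', hT', hsub⟩ := exists_Ico_subset_of_mem_nhds
      (ho.mem_nhds (hm (right_mem_Icc.2 zero_le))) ⟨T + 1, by simp⟩
    refine lt_of_lt_of_le (b := (T' : ℝ≥0∞)) (by exact_mod_cast hT') (le_iInf₂ fun t ht => ?_)
    by_contra hc
    have hc' : t < T' := by exact_mod_cast not_le.1 hc
    rcases le_or_gt t T with h1 | h1
    · exact hm ⟨zero_le, h1⟩ ht
    · exact hsub ⟨h1.le, hc'⟩ ht

theorem isOpen_lt_exitT (hΞ : IsClosed Ξ) (T : ℝ≥0) :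
    IsOpen {γ : CurveSp Ω | (T : ℝ≥0∞) < exitT Ξ γ} := by
  simp_rw [lt_exitT_iff hΞ]
  exact (ContinuousMap.isOpen_setOfPred_mapsTo isCompact_Icc hΞ.isOpen_compl).preimage
    continuous_subtype_val

theorem eventually_lt_exitT (hΞ : IsClosed Ξ) {ι : Type*} {l : Filter ι} {u : ι → CurveSp Ω}
    {γ : CurveSp Ω} (hu : Tendsto u l (𝓝 γ)) {T : ℝ≥0∞} (hT : T < exitT Ξ γ) :
    ∀ᶠ n in l, T < exitT Ξ (u n) := by
  lift T to ℝ≥0 using hT.ne_top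
  exact hu.eventually ((isOpen_lt_exitT hΞ T).mem_nhds hT)

theorem interCost_le_of_tendsto (hΞ : IsClosed Ξ) {α θ : ℝ} (hα : 0 < α) (hθ : 1 < θ)
    (hlb : ∀ t ∈ Ici (0 : ℝ), ∀ x ∈ closure Ω, ∀ p, α * ‖p‖ ^ θ ≤ ℓ t x p)
    (hh : TonelliIntegrand (pairSet (closure Ω)) fun t v w => h t v.fst v.snd w.fst w.snd)
    {u u' : ℕ → CurveSp Ω} {γ γ' : CurveSp Ω}
    (hu : Tendsto u atTop (𝓝 γ)) (hu' : Tendsto u' atTop (𝓝 γ'))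
    {R : ℝ≥0∞} (hR : R ≠ ⊤) (hle : ∀ n, actionCost ℓ (u n) ≤ R)
    (hle' : ∀ n, actionCost ℓ (u' n) ≤ R) {c : ℝ≥0∞}
    (hc : ∀ n, interCost h Ξ (u n) (u' n) ≤ c) :
    interCost h Ξ γ γ' ≤ c := by
  choose g hg using fun n =>
    exists_hasVel_of_actionCost_ne_top (ne_top_of_le_ne_top hR (hle n))
  choose g' hg' using fun n =>
    exists_hasVel_of_actionCost_ne_top (ne_top_of_le_ne_top hR (hle' n))
  have hα' : ENNReal.ofReal α ≠ 0 := by simpa using hα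
  have hvel : ∀ n, IsVel (fun t => WithLp.toLp 2 (CurveSp.path (u n) t, CurveSp.path (u' n) t))
      fun t => WithLp.toLp 2 (g n t, g' n t) := fun n =>
    (hasVel_iff_isVel.1 (hg n)).toLp_prod (hasVel_iff_isVel.1 (hg' n))
  obtain ⟨G, l, hl, hlne, hG, hlsc⟩ := exists_weak_velocity (K := pairSet (closure Ω)) hθ
    (z := fun n t => WithLp.toLp 2 (CurveSp.path (u n) t, CurveSp.path (u' n) t))
    (z' := fun t => WithLp.toLp 2 (CurveSp.path γ t, CurveSp.path γ' t))
    (fun n => (WithLp.prod_continuous_toLp 2 _ _).comp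
      ((CurveSp.continuous_path (u n)).prodMk (CurveSp.continuous_path (u' n))))
    (fun n t => ⟨CurveSp.path_mem (u n) t, CurveSp.path_mem (u' n) t⟩)
    ((WithLp.prod_continuous_toLp 2 _ _).comp
      ((CurveSp.continuous_path γ).prodMk (CurveSp.continuous_path γ')))
    (fun t => ⟨CurveSp.path_mem γ t, CurveSp.path_mem γ' t⟩)
    (fun t => ((WithLp.prod_continuous_toLp 2 _ _).tendsto _).comp
      ((CurveSp.tendsto_path hu t).prodMk_nhds (CurveSp.tendsto_path hu' t)))
    hvel (R := 2 ^ (θ - 1) * ((ENNReal.ofReal α)⁻¹ * R + (ENNReal.ofReal α)⁻¹ * R))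
    (ENNReal.mul_ne_top (by simp) (by simp [hR, hα', ENNReal.mul_eq_top])) (fun n => by
      have hm : AEMeasurable (fun t => ‖g n t‖ₑ ^ θ) (volume.restrict (Ioi (0 : ℝ))) :=
        (hg n).aemeasurable.enorm.pow_const _
      calc ∫⁻ t in Ioi (0 : ℝ), ‖WithLp.toLp 2 (g n t, g' n t)‖ₑ ^ θ
          ≤ ∫⁻ t in Ioi (0 : ℝ), 2 ^ (θ - 1) * (‖g n t‖ₑ ^ θ + ‖g' n t‖ₑ ^ θ) := by
            refine lintegral_mono fun t => ?_
            refine le_trans ?_ (ENNReal.rpow_add_le_mul_rpow_add_rpow _ _ hθ.le)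
            gcongr
            exact enorm_toLp_prod_le _ _
        _ = 2 ^ (θ - 1) * ((∫⁻ t in Ioi (0 : ℝ), ‖g n t‖ₑ ^ θ) +
              ∫⁻ t in Ioi (0 : ℝ), ‖g' n t‖ₑ ^ θ) := by
            rw [lintegral_const_mul' _ _ (by simp), lintegral_add_left' hm]
        _ ≤ _ := by
            gcongr
            · exact (lintegral_rpow_le_actionCost hα (by linarith) hlb (hg n)).trans
                (by gcongr; exact hle n)
            · exact (lintegral_rpow_le_actionCost hα (by linarith) hlb (hg' n)).trans
                (by gcongr; exact hle' n))
  have hG1 : HasVel γ fun t => (G t).fst := hasVel_iff_isVel.2 hG.fst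
  have hG2 : HasVel γ' fun t => (G t).snd := hasVel_iff_isVel.2 hG.snd
  rw [hG1.interCost_eq hG2]
  refine setLIntegral_lt_le_of_forall fun T hT => hlsc _ hh T c ?_
  have h1 := eventually_lt_exitT hΞ hu (lt_min_iff.1 hT).1
  have h2 := eventually_lt_exitT hΞ hu' (lt_min_iff.1 hT).2
  filter_upwards [hl h1, hl h2] with n hn1 hn2
  refine le_trans ?_ (hc n)
  rw [(hg n).interCost_eq (hg' n)]
  refine lintegral_mono_set fun t ht => ⟨ht.1, ?_⟩
  exact lt_of_le_of_lt (ENNReal.ofReal_le_ofReal ht.2) (lt_min hn1 hn2)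
end Curves

section Semicontinuity
variable {Ω Ξ : Set (EucSp d)} {ℓ : ℝ → EucSp d → EucSp d → ℝ}
  {h : ℝ → EucSp d → EucSp d → EucSp d → EucSp d → ℝ} {Ψ : ℝ → ℝ}

theorem PsiExt_mono (Ψ : ℝ → ℝ) : Monotone (PsiExt Ψ) := fun _ _ hST =>
  iSup₂_le fun t ht => le_iSup₂_of_le t (ht.trans hST) le_rfl

theorem PsiExt_coe (hΨmono : MonotoneOn Ψ (Ici 0)) (T : ℝ≥0) :
    PsiExt Ψ T = ENNReal.ofReal (Ψ T) := by
  refine le_antisymm (iSup₂_le fun t ht => ENNReal.ofReal_le_ofReal ?_)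
    (le_iSup₂_of_le T le_rfl le_rfl)
  exact hΨmono t.2 T.2 (by exact_mod_cast ht)

theorem PsiExt_exitT_le_of_tendsto (hΞ : IsClosed Ξ)
    (hΨlsc : LowerSemicontinuousOn Ψ (Ici 0)) {u : ℕ → CurveSp Ω} {γ : CurveSp Ω}
    (hu : Tendsto u atTop (𝓝 γ)) {c : ℝ≥0∞} (hle : ∀ n, PsiExt Ψ (exitT Ξ (u n)) ≤ c) :
    PsiExt Ψ (exitT Ξ γ) ≤ c := by
  refine iSup₂_le fun t ht => ?_
  rcases eq_or_ne t 0 with rfl | h0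
  · exact le_trans (le_iSup₂_of_le (0 : ℝ≥0) (by simp) le_rfl) (hle 0)
  have hpos : (0 : ℝ) < t := by exact_mod_cast pos_iff_ne_zero.2 h0
  refine ENNReal.le_of_forall_pos_le_add fun ε hε _ => ?_
  have h1 := hΨlsc t hpos.le (Ψ t - ε) (by simpa using hε)
  obtain ⟨s, hs, hs0, hst⟩ : ∃ s, Ψ t - ε < Ψ s ∧ 0 < s ∧ s < t := by
    have h2 : Ioo (0 : ℝ) t ∈ 𝓝[<] (t : ℝ) := Ioo_mem_nhdsLT hpos
    have h3 : 𝓝[Ioo (0 : ℝ) t] (t : ℝ) ≤ 𝓝[Ici 0] (t : ℝ) :=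
      nhdsWithin_mono _ fun x hx => hx.1.le
    have h4 : (𝓝[Ioo (0 : ℝ) t] (t : ℝ)).NeBot := by
      rw [nhdsWithin_Ioo_eq_nhdsLT hpos]; infer_instance
    obtain ⟨s, hs, hs'⟩ := (Eventually.and (h1.filter_mono h3) self_mem_nhdsWithin).exists
    exact ⟨s, hs, hs'⟩
  lift s to ℝ≥0 using hs0.le
  have hst' : (s : ℝ≥0∞) < exitT Ξ γ := lt_of_lt_of_le (by exact_mod_cast hst) ht
  obtain ⟨n, hn⟩ := (eventually_lt_exitT hΞ hu hst').exists
  calc ENNReal.ofReal (Ψ t) ≤ ENNReal.ofReal (Ψ s + ε) := ENNReal.ofReal_le_ofReal (by linarith)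
    _ ≤ ENNReal.ofReal (Ψ s) + ε := by simpa using ENNReal.ofReal_add_le (p := Ψ s) (q := (ε : ℝ))
    _ ≤ c + ε := by
      gcongr
      exact le_trans (le_iSup₂_of_le s hn.le le_rfl) (hle n)

theorem lowerSemicontinuous_of_tendsto {X : Type*} [TopologicalSpace X] [FirstCountableTopology X]
    {F : X → ℝ≥0∞} (hF : ∀ (u : ℕ → X) (x : X), Tendsto u atTop (𝓝 x) → ∀ c : ℝ≥0∞, c ≠ ⊤ →
      (∀ n, F (u n) ≤ c) → F x ≤ c) : LowerSemicontinuous F := by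
  rw [lowerSemicontinuous_iff_isClosed_preimage]
  intro c
  rcases eq_or_ne c ⊤ with rfl | hc
  · simp
  · exact IsSeqClosed.isClosed fun u x hu hx => hF u x hx c hc hu

theorem le_liminf_of_tendsto {X : Type*} [TopologicalSpace X]
    {F : X → ℝ≥0∞} {P : X → Prop} (hF : ∀ (u : ℕ → X) (x : X), Tendsto u atTop (𝓝 x) →
      (∀ n, P (u n)) → ∀ c : ℝ≥0∞, (∀ n, F (u n) ≤ c) → F x ≤ c)
    {u : ℕ → X} {x : X} (hu : Tendsto u atTop (𝓝 x)) (hP : ∀ n, P (u n)) :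
    F x ≤ liminf (fun n => F (u n)) atTop := by
  refine le_of_forall_gt_imp_ge_of_dense fun c hc => ?_
  have hfr : ∃ᶠ n in atTop, F (u n) < c := frequently_lt_of_liminf_lt (by isBoundedDefault) hc
  obtain ⟨φ, hφ, hφc⟩ := extraction_of_frequently_atTop hfr
  exact hF (u ∘ φ) x (hu.comp hφ.tendsto_atTop) (fun n => hP _) c fun n => (hφc n).le

theorem measurable_ite_of_isClosed_sublevel {X : Type*} [TopologicalSpace X] [MeasurableSpace X]
    [BorelSpace X] {A F : X → ℝ≥0∞} (hA : Measurable A)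
    (hF : ∀ (k : ℕ) (c : ℝ≥0∞), IsClosed {x | A x ≤ k ∧ F x ≤ c}) :
    Measurable fun x => {x | A x ≠ ⊤}.indicator F x := by
  refine measurable_of_Iic fun c => ?_
  have : (fun x => {x | A x ≠ ⊤}.indicator F x) ⁻¹' Iic c =
      (A ⁻¹' {⊤}) ∪ ⋃ k : ℕ, {x | A x ≤ k ∧ F x ≤ c} := by
    ext x
    by_cases hx : A x = ⊤
    · simp [indicator, hx]
    · simp only [indicator, mem_preimage, mem_Iic, mem_union, mem_iUnion]
      constructor
      · intro hc
        obtain ⟨k, hk⟩ := ENNReal.exists_nat_gt hx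
        exact Or.inr ⟨k, hk.le, by simpa [hx] using hc⟩
      · rintro (h1 | ⟨k, _, h2⟩)
        · exact absurd h1 hx
        · simpa [hx] using h2
  rw [this]
  exact (hA (measurableSet_singleton _)).union
    (MeasurableSet.iUnion fun k => (hF k c).measurableSet)


instance : SecondCountableTopology C(ℝ≥0, EucSp d) := inferInstance
instance : SecondCountableTopology (CurveSp Ω) := TopologicalSpace.Subtype.secondCountableTopology _
end Semicontinuity

section Costs
variable {Ω Ξ : Set (EucSp d)} {ℓ : ℝ → EucSp d → EucSp d → ℝ}
  {h : ℝ → EucSp d → EucSp d → EucSp d → EucSp d → ℝ} {Ψ : ℝ → ℝ} {α θ : ℝ}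

/-- The running cost over the time interval `(0, σ]`. -/
def headCost (ℓ : ℝ → EucSp d → EucSp d → ℝ) (σ : ℝ) (γ : CurveSp Ω) : ℝ≥0∞ :=
  ⨅ (g : ℝ → EucSp d) (_ : HasVel γ g),
    ∫⁻ t in Ioc (0 : ℝ) σ, ENNReal.ofReal (ℓ t (γ.1 t.toNNReal) (g t))

theorem HasVel.headCost_eq {γ : CurveSp Ω} {g : ℝ → EucSp d} (hg : HasVel γ g) (σ : ℝ) :
    headCost ℓ σ γ = ∫⁻ t in Ioc (0 : ℝ) σ, ENNReal.ofReal (ℓ t (γ.1 t.toNNReal) (g t)) := by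
  refine le_antisymm (iInf₂_le g hg) (le_iInf₂ fun g' hg' => (lintegral_congr_ae ?_).le)
  filter_upwards [ae_restrict_of_ae_restrict_of_subset Ioc_subset_Ioi_self (hg.ae_eq hg')]
    with t ht
  rw [ht]

theorem headCost_le_actionCost (σ : ℝ) (γ : CurveSp Ω) : headCost ℓ σ γ ≤ actionCost ℓ γ :=
  iInf₂_mono fun _ _ => lintegral_mono_set Ioc_subset_Ioi_self

theorem tendsto_setLIntegral_Ioc_zero {F : ℝ → ℝ≥0∞} (hF : ∫⁻ t in Ioi (0 : ℝ), F t ≠ ⊤)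
    {σ : ℕ → ℝ} (hσ : Tendsto σ atTop (𝓝 0)) :
    Tendsto (fun n => ∫⁻ t in Ioc 0 (σ n), F t) atTop (𝓝 0) := by
  have h1 : ∀ n, (∫⁻ t in Ioc (0 : ℝ) (σ n), F t) =
      ∫⁻ t in Iic (σ n), F t ∂volume.restrict (Ioi (0 : ℝ)) := fun n => by
    rw [Measure.restrict_restrict measurableSet_Iic, inter_comm]
    rfl
  simp_rw [h1]
  refine tendsto_setLIntegral_zero hF ?_
  refine tendsto_of_tendsto_of_tendsto_of_le_of_le (g := fun _ => 0)
    (h := fun n => ENNReal.ofReal (σ n)) tendsto_const_nhds ?_ (fun _ => zero_le) fun n => ?_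
  · simpa using ENNReal.tendsto_ofReal hσ
  · rw [Function.comp_apply, Measure.restrict_apply measurableSet_Iic, inter_comm, Ioi_inter_Iic]
    simp

theorem tendsto_headCost {γ : CurveSp Ω} (hγ : actionCost ℓ γ ≠ ⊤) {σ : ℕ → ℝ}
    (hσ : Tendsto σ atTop (𝓝 0)) : Tendsto (fun n => headCost ℓ (σ n) γ) atTop (𝓝 0) := by
  obtain ⟨g, hg⟩ := exists_hasVel_of_actionCost_ne_top hγ
  simp_rw [hg.headCost_eq]
  rw [hg.actionCost_eq] at hγ
  exact tendsto_setLIntegral_Ioc_zero hγ hσ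

theorem headCost_le_of_tendsto (hα : 0 < α) (hθ : 1 < θ)
    (hlb : ∀ t ∈ Ici (0 : ℝ), ∀ x ∈ closure Ω, ∀ p, α * ‖p‖ ^ θ ≤ ℓ t x p)
    (hℓ : TonelliIntegrand (closure Ω) ℓ) {u : ℕ → CurveSp Ω} {γ : CurveSp Ω}
    (hu : Tendsto u atTop (𝓝 γ)) {R : ℝ≥0∞} (hR : R ≠ ⊤) (hle : ∀ n, actionCost ℓ (u n) ≤ R)
    (σ : ℝ) {c : ℝ≥0∞} (hc : ∀ n, headCost ℓ σ (u n) ≤ c) :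
    headCost ℓ σ γ ≤ c := by
  choose g hg using fun n =>
    exists_hasVel_of_actionCost_ne_top (ne_top_of_le_ne_top hR (hle n))
  have hα' : ENNReal.ofReal α ≠ 0 := by simpa using hα
  obtain ⟨G, l, hl, hlne, hG, hlsc⟩ := exists_weak_velocity (K := closure Ω) hθ
    (fun n => CurveSp.continuous_path (u n)) (fun n => CurveSp.path_mem (u n))
    (CurveSp.continuous_path γ) (CurveSp.path_mem γ) (CurveSp.tendsto_path hu)
    (fun n => hasVel_iff_isVel.1 (hg n))
    (R := (ENNReal.ofReal α)⁻¹ * R) (ENNReal.mul_ne_top (ENNReal.inv_ne_top.2 hα') hR)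
    (fun n => (lintegral_rpow_le_actionCost hα (by linarith) hlb (hg n)).trans
      (by gcongr; exact hle n))
  rw [(hasVel_iff_isVel.2 hG).headCost_eq]
  refine hlsc ℓ hℓ σ c (Eventually.of_forall fun n => ?_)
  have := hc n
  rwa [(hg n).headCost_eq] at this

theorem lowerSemicontinuous_actionCost (hα : 0 < α) (hθ : 1 < θ)
    (hlb : ∀ t ∈ Ici (0 : ℝ), ∀ x ∈ closure Ω, ∀ p, α * ‖p‖ ^ θ ≤ ℓ t x p)
    (hℓ : TonelliIntegrand (closure Ω) ℓ) :
    LowerSemicontinuous (actionCost ℓ : CurveSp Ω → ℝ≥0∞) :=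
  lowerSemicontinuous_of_tendsto fun _ _ hu _ hc hle =>
    actionCost_le_of_tendsto hα hθ hlb hℓ hu hc hle

theorem lowerSemicontinuous_Lcost (hα : 0 < α) (hθ : 1 < θ)
    (hlb : ∀ t ∈ Ici (0 : ℝ), ∀ x ∈ closure Ω, ∀ p, α * ‖p‖ ^ θ ≤ ℓ t x p)
    (hℓ : TonelliIntegrand (closure Ω) ℓ) (hΞ : IsClosed Ξ)
    (hΨlsc : LowerSemicontinuousOn Ψ (Ici 0)) :
    LowerSemicontinuous (Lcost ℓ Ψ Ξ : CurveSp Ω → ℝ≥0∞) :=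
  (lowerSemicontinuous_actionCost hα hθ hlb hℓ).add <|
    lowerSemicontinuous_of_tendsto fun _ _ hu _ _ hle =>
      PsiExt_exitT_le_of_tendsto hΞ hΨlsc hu hle

theorem aemeasurable_of_isClosed_sublevel {X : Type*} [TopologicalSpace X] [MeasurableSpace X]
    [BorelSpace X] {A F : X → ℝ≥0∞} (hA : Measurable A)
    (hF : ∀ (k : ℕ) (c : ℝ≥0∞), IsClosed {x | A x ≤ k ∧ F x ≤ c}) {Q : Measure X}
    (hQ : ∀ᵐ x ∂Q, A x ≠ ⊤) : AEMeasurable F Q := by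
  refine (measurable_ite_of_isClosed_sublevel hA hF).aemeasurable.congr ?_
  filter_upwards [hQ] with x hx
  exact indicator_of_mem (s := {x | A x ≠ ⊤}) hx F

theorem aemeasurable_headCost (hα : 0 < α) (hθ : 1 < θ)
    (hlb : ∀ t ∈ Ici (0 : ℝ), ∀ x ∈ closure Ω, ∀ p, α * ‖p‖ ^ θ ≤ ℓ t x p)
    (hℓ : TonelliIntegrand (closure Ω) ℓ) {Q : Measure (CurveSp Ω)}
    (hQ : ∀ᵐ γ ∂Q, actionCost ℓ γ ≠ ⊤) (σ : ℝ) :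
    AEMeasurable (headCost ℓ σ) Q := by
  have hA := lowerSemicontinuous_actionCost hα hθ hlb hℓ
  refine aemeasurable_of_isClosed_sublevel hA.measurable (fun k c => ?_) hQ
  refine IsSeqClosed.isClosed fun u x hu hx => ⟨?_, ?_⟩
  · exact actionCost_le_of_tendsto hα hθ hlb hℓ hx (by simp) fun n => (hu n).1
  · exact headCost_le_of_tendsto hα hθ hlb hℓ hx (R := k) (by simp) (fun n => (hu n).1) σ
      fun n => (hu n).2

theorem aemeasurable_interCost (hα : 0 < α) (hθ : 1 < θ)
    (hlb : ∀ t ∈ Ici (0 : ℝ), ∀ x ∈ closure Ω, ∀ p, α * ‖p‖ ^ θ ≤ ℓ t x p)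
    (hℓ : TonelliIntegrand (closure Ω) ℓ) (hΞ : IsClosed Ξ)
    (hh : TonelliIntegrand (pairSet (closure Ω)) fun t v w => h t v.fst v.snd w.fst w.snd)
    {Q : Measure (CurveSp Ω)} (hQ : ∀ᵐ γ ∂Q, actionCost ℓ γ ≠ ⊤) {γ : CurveSp Ω}
    (hγ : actionCost ℓ γ ≠ ⊤) : AEMeasurable (interCost h Ξ γ) Q := by
  have hA := lowerSemicontinuous_actionCost hα hθ hlb hℓ
  refine aemeasurable_of_isClosed_sublevel hA.measurable (fun k c => ?_) hQ
  refine IsSeqClosed.isClosed fun u x hu hx => ⟨?_, ?_⟩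
  · exact actionCost_le_of_tendsto hα hθ hlb hℓ hx (by simp) fun n => (hu n).1
  · exact interCost_le_of_tendsto hΞ hα hθ hlb hh tendsto_const_nhds hx
      (R := k + actionCost ℓ γ) (by simp [hγ]) (fun n => le_add_self)
      (fun n => (hu n).1.trans le_self_add) fun n => (hu n).2

theorem tendsto_lintegral_headCost (hα : 0 < α) (hθ : 1 < θ)
    (hlb : ∀ t ∈ Ici (0 : ℝ), ∀ x ∈ closure Ω, ∀ p, α * ‖p‖ ^ θ ≤ ℓ t x p)
    (hℓ : TonelliIntegrand (closure Ω) ℓ) {Q : Measure (CurveSp Ω)}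
    (hQ : ∫⁻ γ, actionCost ℓ γ ∂Q ≠ ⊤) {σ : ℕ → ℝ} (hσ : Tendsto σ atTop (𝓝 0)) :
    Tendsto (fun n => ∫⁻ γ, headCost ℓ (σ n) γ ∂Q) atTop (𝓝 0) := by
  have hA := lowerSemicontinuous_actionCost hα hθ hlb hℓ
  have hfin : ∀ᵐ γ ∂Q, actionCost ℓ γ ≠ ⊤ := by
    filter_upwards [ae_lt_top hA.measurable hQ] with γ hγ using hγ.ne
  have := tendsto_lintegral_of_dominated_convergence' (μ := Q) (f := fun _ => 0)
    (F := fun n γ => headCost ℓ (σ n) γ) (actionCost ℓ)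
    (fun n => aemeasurable_headCost hα hθ hlb hℓ hfin (σ n))
    (fun n => Eventually.of_forall fun γ => headCost_le_actionCost _ _) hQ
    (by filter_upwards [hfin] with γ hγ using tendsto_headCost hγ hσ)
  simpa using this

theorem ofReal_interaction_le {C β : ℝ} (hα : 0 < α) (hβ : 0 < β) (hβθ : β ≤ θ) (hC : 0 < C)
    {p p' : EucSp d} {L L' H : ℝ} (hL : α * ‖p‖ ^ θ ≤ L) (hL' : α * ‖p'‖ ^ θ ≤ L')
    (hH : H ≤ C * (‖p‖ ^ β + ‖p'‖ ^ β)) :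
    ENNReal.ofReal H ≤ ENNReal.ofReal (2 * C) + ENNReal.ofReal (C / α) * ENNReal.ofReal L +
      ENNReal.ofReal (C / α) * ENNReal.ofReal L' := by
  have key : ∀ r : ℝ, 0 ≤ r → r ^ β ≤ 1 + r ^ θ := fun r hr => by
    rcases le_total r 1 with h1 | h1
    · have := Real.rpow_le_one hr h1 hβ.le
      have := Real.rpow_nonneg hr θ
      linarith
    · have := Real.rpow_le_rpow_of_exponent_le h1 hβθ
      linarith
  have h0 : ∀ (q : EucSp d) (M : ℝ), α * ‖q‖ ^ θ ≤ M → 0 ≤ M ∧ ‖q‖ ^ θ ≤ M / α := fun q M hM => by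
    refine ⟨le_trans (by positivity) hM, ?_⟩
    rw [le_div_iff₀ hα]; linarith
  obtain ⟨h1, h2⟩ := h0 p L hL
  obtain ⟨h3, h4⟩ := h0 p' L' hL'
  rw [← ENNReal.ofReal_mul (by positivity), ← ENNReal.ofReal_mul (by positivity),
    ← ENNReal.ofReal_add (by positivity) (by positivity),
    ← ENNReal.ofReal_add (by positivity) (by positivity)]
  refine ENNReal.ofReal_le_ofReal (hH.trans ?_)
  have h5 := key _ (norm_nonneg p)
  have h6 := key _ (norm_nonneg p')
  calc C * (‖p‖ ^ β + ‖p'‖ ^ β) ≤ C * (2 + L / α + L' / α) :=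
        mul_le_mul_of_nonneg_left (by linarith) hC.le
    _ = 2 * C + C / α * L + C / α * L' := by ring
end Costs

section ArcLength
variable {E : Type*} [MetricSpace E]

theorem edist_add_eVariationOn_le (f : ℝ → E) {a s t : ℝ} (has : a ≤ s) (hst : s ≤ t) :
    edist (f s) (f t) + eVariationOn f (Icc a s) ≤ eVariationOn f (Icc a t) := by
  have h := eVariationOn.Icc_add_Icc f (s := univ) has hst (mem_univ s)
  simp only [univ_inter] at h
  rw [← h, add_comm]
  gcongr
  exact eVariationOn.edist_le f (left_mem_Icc.2 hst) (right_mem_Icc.2 hst)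

theorem exists_lipschitzWith_of_eVariationOn_le {f : ℝ → E} (hf : Continuous f) {D : ℝ}
    (hD : eVariationOn f (Icc 0 1) ≤ ENNReal.ofReal D) :
    ∃ G : ℝ → E, LipschitzWith 1 G ∧ (∀ t, G t ∈ f '' Icc 0 1) ∧ G 0 = f 0 ∧ G D = f 1 := by
  let A : ℝ → Set ℝ := fun y => {s ∈ Icc (0 : ℝ) 1 | eVariationOn f (Icc 0 s) ≤ ENNReal.ofReal y}
  have h0 : ∀ y, (0 : ℝ) ∈ A y := fun y => ⟨by simp, by
    rw [Icc_self, eVariationOn.subsingleton f subsingleton_singleton]; exact zero_le⟩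
  have hbd : ∀ y, BddAbove (A y) := fun y => ⟨1, fun s hs => hs.1.2⟩
  have hsup0 : ∀ y, 0 ≤ sSup (A y) := fun y => le_csSup (hbd y) (h0 y)
  have hsup1 : ∀ y, sSup (A y) ≤ 1 := fun y => csSup_le ⟨0, h0 y⟩ fun s hs => hs.1.2
  have hlt : ∀ y s, 0 ≤ s → s < sSup (A y) → eVariationOn f (Icc 0 s) ≤ ENNReal.ofReal y := by
    intro y s hs0 hs
    obtain ⟨r, hr, hsr⟩ := exists_lt_of_lt_csSup ⟨0, h0 y⟩ hs
    exact (eVariationOn.mono f (Icc_subset_Icc le_rfl hsr.le)).trans hr.2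
  have hgt : ∀ y s, s ≤ 1 → sSup (A y) < s → ENNReal.ofReal y ≤ eVariationOn f (Icc 0 s) := by
    intro y s hs1 hs
    by_contra hc
    exact absurd (le_csSup (hbd y) ⟨⟨(hsup0 y).trans hs.le, hs1⟩, (not_le.1 hc).le⟩) (not_le.2 hs)
  have key : ∀ y y', y ≤ y' →
      edist (f (sSup (A y))) (f (sSup (A y'))) ≤ ENNReal.ofReal (y' - y) := by
    intro y y' hy
    have hle : sSup (A y) ≤ sSup (A y') := csSup_le_csSup (hbd y') ⟨0, h0 y⟩ fun s hs =>
      ⟨hs.1, hs.2.trans (ENNReal.ofReal_le_ofReal hy)⟩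
    rcases hle.eq_or_lt with he | hl
    · simp [he]
    have h1 : ∀ s₁ s₂, sSup (A y) < s₁ → s₁ < s₂ → s₂ < sSup (A y') →
        edist (f s₁) (f s₂) ≤ ENNReal.ofReal (y' - y) := by
      intro s₁ s₂ h1 h2 h3
      have h4 := edist_add_eVariationOn_le f ((hsup0 y).trans h1.le) h2.le
      have h5 := hgt y s₁ (by linarith [hsup1 y']) h1
      have h6 := hlt y' s₂ (by linarith [hsup0 y]) h3
      have h7 : edist (f s₁) (f s₂) + ENNReal.ofReal y ≤ ENNReal.ofReal y' :=
        le_trans (by gcongr) (h4.trans h6)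
      have h8 := ENNReal.le_sub_of_add_le_right ENNReal.ofReal_ne_top h7
      rcases le_total 0 y with hy0 | hy0
      · rwa [← ENNReal.ofReal_sub _ hy0] at h8
      · refine h8.trans (tsub_le_self.trans (ENNReal.ofReal_le_ofReal (by linarith)))
    have h2 : ∀ s₂, sSup (A y) < s₂ → s₂ < sSup (A y') →
        edist (f (sSup (A y))) (f s₂) ≤ ENNReal.ofReal (y' - y) := by
      intro s₂ h2 h3
      refine le_of_tendsto (f := fun s => edist (f s) (f s₂)) (x := 𝓝[>] (sSup (A y)))
        (((hf.edist continuous_const).tendsto _).mono_left nhdsWithin_le_nhds) ?_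
      filter_upwards [Ioo_mem_nhdsGT h2] with s hs using h1 s s₂ hs.1 hs.2 h3
    refine le_of_tendsto (f := fun s => edist (f (sSup (A y))) (f s)) (x := 𝓝[<] (sSup (A y')))
      (((continuous_const.edist hf).tendsto _).mono_left nhdsWithin_le_nhds) ?_
    filter_upwards [Ioo_mem_nhdsLT hl] with s hs using h2 s hs.1 hs.2
  refine ⟨fun y => f (sSup (A y)), fun y y' => ?_, fun y => ⟨_, ⟨hsup0 y, hsup1 y⟩, rfl⟩, ?_, ?_⟩
  · rw [ENNReal.coe_one, one_mul]
    rcases le_total y y' with hy | hy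
    · refine (key y y' hy).trans (le_of_eq ?_)
      rw [edist_comm, edist_dist, Real.dist_eq, abs_of_nonneg (by linarith)]
    · rw [edist_comm]
      refine (key y' y hy).trans (le_of_eq ?_)
      rw [edist_dist, Real.dist_eq, abs_of_nonneg (by linarith)]
  · rcases (hsup0 0).eq_or_lt with he | hl
    · beta_reduce
      rw [← he]
    · have h1 : edist (f 0) (f (sSup (A 0))) ≤ 0 := by
        refine le_of_tendsto (f := fun s => edist (f 0) (f s)) (x := 𝓝[<] (sSup (A 0)))
          (((continuous_const.edist hf).tendsto _).mono_left nhdsWithin_le_nhds) ?_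
        filter_upwards [Ioo_mem_nhdsLT hl] with s hs
        have h2 := hlt 0 s hs.1.le hs.2
        rw [ENNReal.ofReal_zero] at h2
        exact (eVariationOn.edist_le f (left_mem_Icc.2 hs.1.le)
          (right_mem_Icc.2 hs.1.le)).trans h2
      exact (edist_le_zero.1 h1).symm
  · have : sSup (A D) = 1 :=
      le_antisymm (hsup1 D) (le_csSup (hbd D) ⟨⟨zero_le_one, le_rfl⟩, hD⟩)
    beta_reduce
    rw [this]
end ArcLength

theorem exists_lipschitzWith_of_geoDist_lt {S : Set (EucSp d)} {x y : EucSp d} {D : ℝ}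
    (hD : geoDist S x y < ENNReal.ofReal D) :
    ∃ G : ℝ → EucSp d, LipschitzWith 1 G ∧ (∀ t, G t ∈ S) ∧ G 0 = x ∧ G D = y := by
  simp only [geoDist, iInf_lt_iff] at hD
  obtain ⟨f, hf, hfS, h0, h1, hlt⟩ := hD
  have heq : EqOn (IccExtend zero_le_one ((Icc (0 : ℝ) 1).domRestrict f)) f (Icc 0 1) :=
    fun t ht => by rw [IccExtend_of_mem _ _ ht]; rfl
  obtain ⟨G, hG, hGm, hG0, hG1⟩ := exists_lipschitzWith_of_eVariationOn_le
    (f := IccExtend zero_le_one ((Icc (0 : ℝ) 1).domRestrict f))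
    (continuous_IccExtend_iff.2 hf.domRestrict) (D := D)
    (by rw [eVariationOn.eq_of_eqOn heq]; exact hlt.le)
  refine ⟨G, hG, fun t => ?_, ?_, ?_⟩
  · obtain ⟨s, hs, hst⟩ := hGm t
    rw [← hst, heq hs]
    exact hfS s hs
  · rw [hG0, heq (by simp), h0]
  · rw [hG1, heq (by simp), h1]

section Detour
variable {Ω Ξ : Set (EucSp d)}

theorem lintegral_Ioc_comp_two_mul_sub_le (F : ℝ → ℝ≥0∞) (D : ℝ) :
    ∫⁻ t in Ioc D (2 * D), F (2 * t - 2 * D) ≤ ∫⁻ t in Ioc 0 (2 * D), F t := by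
  have h := lintegral_image_eq_lintegral_abs_deriv_mul (s := Ioc D (2 * D))
    (f := fun t : ℝ => 2 * t - 2 * D) (f' := fun _ => 2) measurableSet_Ioc
    (fun t _ => by simpa using
      (((hasDerivAt_id t).const_mul (2 : ℝ)).sub_const (2 * D)).hasDerivWithinAt)
    (fun t _ s _ hts => by simpa using hts) F
  have himg : (fun t : ℝ => 2 * t - 2 * D) '' Ioc D (2 * D) = Ioc 0 (2 * D) := by
    ext s
    constructor
    · rintro ⟨t, ht, rfl⟩
      exact ⟨by linarith [ht.1], by linarith [ht.2]⟩
    · intro hs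
      exact ⟨s / 2 + D, ⟨by linarith [hs.1], by linarith [hs.2]⟩, by ring⟩
  rw [himg] at h
  rw [h]
  refine lintegral_mono fun t => le_mul_of_one_le_left zero_le ?_
  rw [ENNReal.one_le_ofReal]
  norm_num

open Classical in
theorem HasVel.exists_detour {ω : CurveSp Ω} {g : ℝ → EucSp d} (hg : HasVel ω g) {D : ℝ}
    (hD : 0 < D) {G : ℝ → EucSp d} (hG : LipschitzWith 1 G) (hGm : ∀ t, G t ∈ closure Ω)
    (hGD : G D = ω.1 0) {θ : ℝ} (hθ : 0 ≤ θ) :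
    ∃ (ω' : CurveSp Ω) (g' : ℝ → EucSp d), HasVel ω' g' ∧ ω'.1 0 = G 0 ∧
      (∀ t : ℝ≥0, t ≤ 2 * D → ∃ s : ℝ≥0, s ≤ 2 * D ∧ ω'.1 s = ω.1 t) ∧
      (∀ t : ℝ≥0, 2 * D ≤ t → ω'.1 t = ω.1 t) ∧ (∀ t, 2 * D < t → g' t = g t) ∧
      ∫⁻ t in Ioc 0 (2 * D), ‖g' t‖ₑ ^ θ ≤
        ENNReal.ofReal D + 2 ^ θ * ∫⁻ t in Ioc 0 (2 * D), ‖g t‖ₑ ^ θ := by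
  have hω := hasVel_iff_isVel.1 hg
  have hωc := CurveSp.continuous_path ω
  have e1 : G D = CurveSp.path ω (2 * D - 2 * D) := by
    rw [hGD, sub_self]; simp [CurveSp.path]
  have v1 := hG.isVel_deriv.concat hD.le (hω.comp_two_mul_sub D) e1
  have e2 : (Iic D).piecewise G (fun t => CurveSp.path ω (2 * t - 2 * D)) (2 * D) =
      CurveSp.path ω (2 * D) := by
    rw [piecewise_eq_of_notMem (Iic D) _ _
      (not_le.2 (show D < 2 * D by linarith))]
    congr 1
    ring
  have hD2 : 0 ≤ 2 * D := by linarith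
  have v2 := v1.concat (σ := 2 * D) hD2 (hω.isVelFrom hD2) e2
  have c1 : Continuous ((Iic D).piecewise G (fun t => CurveSp.path ω (2 * t - 2 * D))) := by
    refine Continuous.piecewise (fun t ht => ?_) hG.continuous (hωc.comp (by fun_prop))
    rw [frontier_Iic, mem_singleton_iff] at ht
    rw [ht]; exact e1
  have c2 : Continuous ((Iic (2 * D)).piecewise
      ((Iic D).piecewise G (fun t => CurveSp.path ω (2 * t - 2 * D))) (CurveSp.path ω)) := by
    refine Continuous.piecewise (fun t ht => ?_) c1 hωc
    rw [frontier_Iic, mem_singleton_iff] at ht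
    rw [ht]; exact e2
  set z := (Iic (2 * D)).piecewise
      ((Iic D).piecewise G (fun t => CurveSp.path ω (2 * t - 2 * D))) (CurveSp.path ω) with hz
  have hzm : ∀ t, z t ∈ closure Ω := by
    intro t
    simp only [hz, piecewise]
    split_ifs
    · exact hGm t
    · exact CurveSp.path_mem _ _
    · exact CurveSp.path_mem _ _
  refine ⟨⟨⟨fun t => z t, c2.comp NNReal.continuous_coe⟩, fun t => hzm t⟩, _,
    hasVel_iff_isVel.2 (⟨v2.1, fun t ht => ?_⟩ : IsVel _ _), ?_, fun t ht => ?_, fun t ht => ?_,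
    fun t ht => ?_, ?_⟩
  · have := v2.2 t ht
    simpa [CurveSp.path, Real.coe_toNNReal t ht] using this
  · simp [hz, piecewise, hD.le]
  · have ht0 : (0 : ℝ) ≤ t := t.2
    refine ⟨⟨t / 2 + D, by positivity⟩, ?_, ?_⟩
    · change (t : ℝ) / 2 + D ≤ 2 * D
      linarith
    change z (t / 2 + D) = _
    rw [hz, piecewise_eq_of_mem (Iic (2 * D)) _ _ (show (t : ℝ) / 2 + D ≤ 2 * D by linarith)]
    have e3 : CurveSp.path ω (2 * ((t : ℝ) / 2 + D) - 2 * D) = ω.1 t := by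
      rw [show 2 * ((t : ℝ) / 2 + D) - 2 * D = t by ring]
      simp [CurveSp.path]
    rcases ht0.eq_or_lt with he | hl
    · rw [piecewise_eq_of_mem (Iic D) _ _ (show (t : ℝ) / 2 + D ≤ D by linarith), ← he]
      simp only [zero_div, zero_add]
      rw [hGD]
      congr 1
      exact_mod_cast he
    · rw [piecewise_eq_of_notMem (Iic D) _ _ (not_le.2 (show D < (t : ℝ) / 2 + D by linarith)), e3]
  · change z t = _
    rcases ht.eq_or_lt with he | hl
    · rw [hz, ← he, piecewise_eq_of_mem (Iic (2 * D)) _ _ (mem_Iic.2 le_rfl), e2, he]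
      simp [CurveSp.path]
    · rw [hz, piecewise_eq_of_notMem (Iic (2 * D)) _ _ (not_le.2 hl)]
      simp [CurveSp.path]
  · exact piecewise_eq_of_notMem (Iic (2 * D)) _ _ (not_le.2 ht)
  · rw [← Ioc_union_Ioc_eq_Ioc hD.le (by linarith : D ≤ 2 * D),
      lintegral_union measurableSet_Ioc (Ioc_disjoint_Ioc_of_le le_rfl),
      Ioc_union_Ioc_eq_Ioc hD.le (by linarith : D ≤ 2 * D)]
    gcongr
    · calc _ ≤ ∫⁻ t in Ioc 0 D, 1 := by
            refine setLIntegral_mono' measurableSet_Ioc fun t ht => ?_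
            rw [piecewise_eq_of_mem (Iic (2 * D)) _ _ (mem_Iic.2 (by linarith [ht.2])),
              piecewise_eq_of_mem (Iic D) _ _ ht.2]
            refine ENNReal.rpow_le_one ?_ hθ
            rw [← ofReal_norm, ENNReal.ofReal_le_one]
            simpa using norm_deriv_le_of_lipschitz hG (x₀ := t)
        _ = ENNReal.ofReal D := by simp
    · calc _ ≤ ∫⁻ t in Ioc D (2 * D), 2 ^ θ * ‖g (2 * t - 2 * D)‖ₑ ^ θ := by
            refine setLIntegral_mono' measurableSet_Ioc fun t ht => ?_
            rw [piecewise_eq_of_mem (Iic (2 * D)) _ _ (mem_Iic.2 ht.2),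
              piecewise_eq_of_notMem (Iic D) _ _ (not_le.2 ht.1), enorm_smul,
              ENNReal.mul_rpow_of_nonneg _ _ hθ]
            gcongr
            simp [enorm]
        _ = 2 ^ θ * ∫⁻ t in Ioc D (2 * D), ‖g (2 * t - 2 * D)‖ₑ ^ θ :=
            lintegral_const_mul' _ _ (ENNReal.rpow_ne_top_of_nonneg hθ (by simp))
        _ ≤ _ := by
            exact mul_le_mul_right
              (lintegral_Ioc_comp_two_mul_sub_le (fun t => ‖g t‖ₑ ^ θ) D) _
end Detour

section Comparison
variable {Ω Ξ : Set (EucSp d)} {ℓ : ℝ → EucSp d → EucSp d → ℝ}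
  {h : ℝ → EucSp d → EucSp d → EucSp d → EucSp d → ℝ} {α θ : ℝ}

theorem actionCost_le_add_headCost {ω ω' : CurveSp Ω} {g g' : ℝ → EucSp d} (hg : HasVel ω g)
    (hg' : HasVel ω' g') {σ : ℝ} (hσ : 0 ≤ σ) (hω : ∀ t : ℝ≥0, σ ≤ t → ω'.1 t = ω.1 t)
    (hgg : ∀ t, σ < t → g' t = g t) :
    actionCost ℓ ω' ≤ actionCost ℓ ω + headCost ℓ σ ω' := by
  rw [hg.actionCost_eq, hg'.actionCost_eq, hg'.headCost_eq, add_comm]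
  have hsub : Ioi (0 : ℝ) ⊆ Ioc 0 σ ∪ Ioi σ := (Ioc_union_Ioi_eq_Ioi hσ).ge
  refine (lintegral_mono_set hsub).trans ((lintegral_union_le _ _ _).trans ?_)
  refine add_le_add le_rfl (le_trans (le_of_eq ?_) (lintegral_mono_set (Ioi_subset_Ioi hσ)))
  refine setLIntegral_congr_fun measurableSet_Ioi fun t ht => ?_
  have ht' : σ < t := ht
  rw [hgg t ht', hω t.toNNReal
    (by rw [Real.coe_toNNReal t (hσ.trans ht'.le)]; exact ht'.le)]

theorem headCost_le {αast : ℝ} (hθ : 0 ≤ θ) (hα : 0 ≤ αast)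
    (hub : ∀ t ∈ Ici (0 : ℝ), ∀ x ∈ closure Ω, ∀ p, ℓ t x p ≤ αast * ‖p‖ ^ θ)
    {γ : CurveSp Ω} {g : ℝ → EucSp d} (hg : HasVel γ g) (σ : ℝ) :
    headCost ℓ σ γ ≤ ENNReal.ofReal αast * ∫⁻ t in Ioc 0 σ, ‖g t‖ₑ ^ θ := by
  rw [hg.headCost_eq, ← lintegral_const_mul' _ _ ENNReal.ofReal_ne_top]
  refine setLIntegral_mono' measurableSet_Ioc fun t ht => ?_
  rw [← ofReal_norm, ENNReal.ofReal_rpow_of_nonneg (norm_nonneg _) hθ, ← ENNReal.ofReal_mul hα]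
  exact ENNReal.ofReal_le_ofReal (hub t ht.1.le _ (γ.2 _) _)

theorem exitT_le_max {ω ω' : CurveSp Ω} {σ : ℝ}
    (hσ : ∀ t : ℝ≥0, t ≤ σ → ∃ s : ℝ≥0, s ≤ σ ∧ ω'.1 s = ω.1 t)
    (hω : ∀ t : ℝ≥0, σ ≤ t → ω'.1 t = ω.1 t) :
    exitT Ξ ω' ≤ max (exitT Ξ ω) (ENNReal.ofReal σ) := by
  rw [← not_lt, max_lt_iff]
  rintro ⟨h1, h2⟩
  simp only [exitT, iInf_lt_iff] at h1
  obtain ⟨t, ht, hlt⟩ := h1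
  rcases le_total (t : ℝ) σ with hts | hts
  · obtain ⟨s, hs, hst⟩ := hσ t hts
    refine absurd h2 (not_lt.2 ((iInf₂_le s (by rwa [hst])).trans ?_))
    rw [← ENNReal.ofReal_coe_nnreal]
    exact ENNReal.ofReal_le_ofReal hs
  · exact absurd hlt (not_lt.2 (iInf₂_le t (by rwa [hω t hts])))

theorem interCost_le_add_headCost {C β : ℝ} (hα : 0 < α) (hβ : 0 < β) (hβθ : β ≤ θ) (hC : 0 < C)
    (hlb : ∀ t ∈ Ici (0 : ℝ), ∀ x ∈ closure Ω, ∀ p, α * ‖p‖ ^ θ ≤ ℓ t x p)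
    (hℓ : TonelliIntegrand (closure Ω) ℓ)
    (hhub : ∀ t ∈ Ici (0 : ℝ), ∀ x ∈ closure Ω, ∀ x' ∈ closure Ω, ∀ p p',
      h t x x' p p' ≤ C * (‖p‖ ^ β + ‖p'‖ ^ β))
    {ω ω' γ : CurveSp Ω} {g g' gγ : ℝ → EucSp d} (hg : HasVel ω g)
    (hg' : HasVel ω' g') (hγ : HasVel γ gγ) {σ : ℝ} (hσ : 0 ≤ σ)
    (hω : ∀ t : ℝ≥0, σ ≤ t → ω'.1 t = ω.1 t) (hgg : ∀ t, σ < t → g' t = g t)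
    (hτ : exitT Ξ ω' ≤ max (exitT Ξ ω) (ENNReal.ofReal σ)) :
    interCost h Ξ ω' γ ≤ interCost h Ξ ω γ + (ENNReal.ofReal (2 * C) * ENNReal.ofReal σ +
      ENNReal.ofReal (C / α) * headCost ℓ σ ω' + ENNReal.ofReal (C / α) * headCost ℓ σ γ) := by
  have haem : ∀ {ω : CurveSp Ω} {g : ℝ → EucSp d}, HasVel ω g → AEMeasurable
      (fun t => ENNReal.ofReal (ℓ t (ω.1 t.toNNReal) (g t))) (volume.restrict (Ioc 0 σ)) :=
    fun {ω g} hg => ((hℓ.aemeasurable (CurveSp.continuous_path ω) (CurveSp.path_mem ω)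
      hg.aemeasurable).ennreal_ofReal).mono_measure
      (Measure.restrict_mono Ioc_subset_Ioi_self le_rfl)
  rw [hg'.interCost_eq hγ, hg.interCost_eq hγ, hg'.headCost_eq, hγ.headCost_eq]
  set S := {t : ℝ | 0 < t ∧ ENNReal.ofReal t < min (exitT Ξ ω) (exitT Ξ γ)} with hS
  have hSm : MeasurableSet (S ∩ Ioi σ) := by
    refine MeasurableSet.inter (MeasurableSet.inter measurableSet_Ioi ?_) measurableSet_Ioi
    exact measurableSet_lt ENNReal.measurable_ofReal measurable_const
  have hsub : {t : ℝ | 0 < t ∧ ENNReal.ofReal t < min (exitT Ξ ω') (exitT Ξ γ)} ⊆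
      (S ∩ Ioi σ) ∪ Ioc 0 σ := by
    rintro t ⟨h0, ht⟩
    rcases le_or_gt t σ with hts | hts
    · exact Or.inr ⟨h0, hts⟩
    · refine Or.inl ⟨⟨h0, lt_min ?_ (ht.trans_le (min_le_right _ _))⟩, hts⟩
      rcases lt_max_iff.1 ((ht.trans_le (min_le_left _ _)).trans_le hτ) with h1 | h1
      · exact h1
      · exact absurd ((ENNReal.ofReal_lt_ofReal_iff_of_nonneg h0.le).1 h1) (not_lt.2 hts.le)
  refine (lintegral_mono_set hsub).trans ((lintegral_union_le _ _ _).trans (add_le_add ?_ ?_))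
  · refine le_trans (le_of_eq ?_) (lintegral_mono_set (inter_subset_left (t := Ioi σ)))
    refine setLIntegral_congr_fun hSm fun t ht => ?_
    have ht' : σ < t := ht.2
    rw [hgg t ht', hω t.toNNReal
      (by rw [Real.coe_toNNReal t (hσ.trans ht'.le)]; exact ht'.le)]
  · calc _ ≤ ∫⁻ t in Ioc 0 σ, (ENNReal.ofReal (2 * C) +
            ENNReal.ofReal (C / α) * ENNReal.ofReal (ℓ t (ω'.1 t.toNNReal) (g' t)) +
            ENNReal.ofReal (C / α) * ENNReal.ofReal (ℓ t (γ.1 t.toNNReal) (gγ t))) :=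
          setLIntegral_mono' measurableSet_Ioc fun t ht =>
            ofReal_interaction_le hα hβ hβθ hC (hlb t ht.1.le _ (ω'.2 _) _)
              (hlb t ht.1.le _ (γ.2 _) _) (hhub t ht.1.le _ (ω'.2 _) _ (γ.2 _) _ _)
      _ = _ := by
          rw [lintegral_add_right' _ ((haem hγ).const_mul _),
            lintegral_add_right' _ ((haem hg').const_mul _),
            lintegral_const_mul' _ _ ENNReal.ofReal_ne_top,
            lintegral_const_mul' _ _ ENNReal.ofReal_ne_top]
          simp
end Comparison

section Approximation
variable {Ω Ξ : Set (EucSp d)} {ℓ : ℝ → EucSp d → EucSp d → ℝ}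
  {h : ℝ → EucSp d → EucSp d → EucSp d → EucSp d → ℝ} {α θ : ℝ}

theorem exists_approx_of_tendsto_geoDist {C β αast : ℝ} (hα : 0 < α) (hθ : 0 ≤ θ)
    (hβ : 0 < β) (hβθ : β ≤ θ) (hC : 0 < C) (hαast : 0 ≤ αast)
    (hlb : ∀ t ∈ Ici (0 : ℝ), ∀ x ∈ closure Ω, ∀ p, α * ‖p‖ ^ θ ≤ ℓ t x p)
    (hub : ∀ t ∈ Ici (0 : ℝ), ∀ x ∈ closure Ω, ∀ p, ℓ t x p ≤ αast * ‖p‖ ^ θ)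
    (hℓ : TonelliIntegrand (closure Ω) ℓ)
    (hhub : ∀ t ∈ Ici (0 : ℝ), ∀ x ∈ closure Ω, ∀ x' ∈ closure Ω, ∀ p p',
      h t x x' p p' ≤ C * (‖p‖ ^ β + ‖p'‖ ^ β))
    {ω : CurveSp Ω} (hω : actionCost ℓ ω ≠ ⊤) {u : ℕ → EucSp d}
    (hu : Tendsto (fun n => geoDist (closure Ω) (u n) (ω.1 0)) atTop (𝓝 0)) :
    ∃ (v : ℕ → CurveSp Ω) (σ : ℕ → ℝ) (e : ℕ → ℝ≥0∞), Tendsto σ atTop (𝓝 0) ∧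
      Tendsto e atTop (𝓝 0) ∧ ∀ᶠ n in atTop, (v n).1 0 = u n ∧
        actionCost ℓ (v n) ≤ actionCost ℓ ω + e n ∧
        exitT Ξ (v n) ≤ max (exitT Ξ ω) (ENNReal.ofReal (σ n)) ∧
        ∀ γ : CurveSp Ω, actionCost ℓ γ ≠ ⊤ → interCost h Ξ (v n) γ ≤
          interCost h Ξ ω γ + (e n + ENNReal.ofReal (C / α) * headCost ℓ (σ n) γ) := by
  obtain ⟨g, hg⟩ := exists_hasVel_of_actionCost_ne_top hω
  have hα' : ENNReal.ofReal α ≠ 0 := by simpa using hα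
  have hgfin : ∫⁻ t in Ioi (0 : ℝ), ‖g t‖ₑ ^ θ ≠ ⊤ :=
    ne_top_of_le_ne_top (ENNReal.mul_ne_top (ENNReal.inv_ne_top.2 hα') hω)
      (lintegral_rpow_le_actionCost hα hθ hlb hg)
  set r : ℕ → ℝ≥0∞ := fun n => geoDist (closure Ω) (u n) (ω.1 0) + ((n : ℝ≥0∞) + 1)⁻¹ with hr
  have hrlim : Tendsto r atTop (𝓝 0) := by
    have h1 : Tendsto (fun n : ℕ => ((n : ℝ≥0∞) + 1)⁻¹) atTop (𝓝 0) := by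
      have := (tendsto_add_atTop_iff_nat 1).2 ENNReal.tendsto_inv_nat_nhds_zero
      simpa using this
    simpa using hu.add h1
  set D : ℕ → ℝ := fun n => (r n).toReal with hD
  have hDlim : Tendsto D atTop (𝓝 0) := by
    simpa [hD, Function.comp_def] using (ENNReal.tendsto_toReal ENNReal.zero_ne_top).comp hrlim
  have hσlim : Tendsto (fun n => 2 * D n) atTop (𝓝 0) := by simpa using hDlim.const_mul 2
  have hfin : ∀ᶠ n in atTop, r n < ⊤ := hrlim.eventually (gt_mem_nhds (by simp))
  have key : ∀ᶠ n in atTop, ∃ (ω' : CurveSp Ω) (g' : ℝ → EucSp d), 0 < D n ∧ HasVel ω' g' ∧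
      ω'.1 0 = u n ∧ (∀ t : ℝ≥0, t ≤ 2 * D n → ∃ s : ℝ≥0, s ≤ 2 * D n ∧ ω'.1 s = ω.1 t) ∧
      (∀ t : ℝ≥0, 2 * D n ≤ t → ω'.1 t = ω.1 t) ∧ (∀ t, 2 * D n < t → g' t = g t) ∧
      ∫⁻ t in Ioc 0 (2 * D n), ‖g' t‖ₑ ^ θ ≤
        ENNReal.ofReal (D n) + 2 ^ θ * ∫⁻ t in Ioc 0 (2 * D n), ‖g t‖ₑ ^ θ := by
    filter_upwards [hfin] with n hn
    have h1 : geoDist (closure Ω) (u n) (ω.1 0) < r n :=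
      ENNReal.lt_add_right (ne_top_of_le_ne_top hn.ne le_self_add) (by simp)
    have h2 : ENNReal.ofReal (D n) = r n := ENNReal.ofReal_toReal hn.ne
    obtain ⟨G, hG, hGm, hG0, hGD⟩ := exists_lipschitzWith_of_geoDist_lt (h2 ▸ h1)
    have hDpos : 0 < D n := ENNReal.toReal_pos (pos_of_gt h1).ne' hn.ne
    obtain ⟨ω', g', h3, h4, h5⟩ := hg.exists_detour hDpos hG hGm hGD hθ
    exact ⟨ω', g', hDpos, h3, h4.trans hG0, h5⟩
  have key' : ∃ (v : ℕ → CurveSp Ω) (g' : ℕ → ℝ → EucSp d), ∀ᶠ n in atTop, 0 < D n ∧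
      HasVel (v n) (g' n) ∧ (v n).1 0 = u n ∧
      (∀ t : ℝ≥0, t ≤ 2 * D n → ∃ s : ℝ≥0, s ≤ 2 * D n ∧ (v n).1 s = ω.1 t) ∧
      (∀ t : ℝ≥0, 2 * D n ≤ t → (v n).1 t = ω.1 t) ∧ (∀ t, 2 * D n < t → g' n t = g t) ∧
      ∫⁻ t in Ioc 0 (2 * D n), ‖g' n t‖ₑ ^ θ ≤
        ENNReal.ofReal (D n) + 2 ^ θ * ∫⁻ t in Ioc 0 (2 * D n), ‖g t‖ₑ ^ θ := by
    have : Nonempty (CurveSp Ω) := ⟨ω⟩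
    obtain ⟨v, hv⟩ := key.choice
    obtain ⟨g', hg'⟩ := hv.choice
    exact ⟨v, g', hg'⟩
  obtain ⟨v, g', hv⟩ := key'
  set E : ℕ → ℝ≥0∞ := fun n => ENNReal.ofReal αast * (ENNReal.ofReal (D n) +
    2 ^ θ * ∫⁻ t in Ioc 0 (2 * D n), ‖g t‖ₑ ^ θ) with hE
  have hElim : Tendsto E atTop (𝓝 0) := by
    have h1 : Tendsto (fun n => ENNReal.ofReal (D n)) atTop (𝓝 0) := by
      simpa using ENNReal.tendsto_ofReal hDlim
    have h2 := ENNReal.Tendsto.const_mul (a := 2 ^ θ) (tendsto_setLIntegral_Ioc_zero hgfin hσlim)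
      (Or.inr (ENNReal.rpow_ne_top_of_nonneg hθ (by simp)))
    have h3 := ENNReal.Tendsto.const_mul (a := ENNReal.ofReal αast) (h1.add h2)
      (Or.inr ENNReal.ofReal_ne_top)
    simpa using h3
  refine ⟨v, fun n => 2 * D n, fun n => E n + (ENNReal.ofReal (2 * C) * ENNReal.ofReal (2 * D n) +
    ENNReal.ofReal (C / α) * E n), hσlim, ?_, ?_⟩
  · have h1 : Tendsto (fun n => ENNReal.ofReal (2 * D n)) atTop (𝓝 0) := by
      simpa using ENNReal.tendsto_ofReal hσlim
    have h2 := ENNReal.Tendsto.const_mul (a := ENNReal.ofReal (2 * C)) h1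
      (Or.inr ENNReal.ofReal_ne_top)
    have h3 := ENNReal.Tendsto.const_mul (a := ENNReal.ofReal (C / α)) hElim
      (Or.inr ENNReal.ofReal_ne_top)
    simpa using hElim.add (h2.add h3)
  · filter_upwards [hv] with n ⟨hDn, hvel, hv0, hback, hfwd, hgg, hbd⟩
    have hσ : 0 ≤ 2 * D n := by linarith
    have hhead : headCost ℓ (2 * D n) (v n) ≤ E n :=
      (headCost_le hθ hαast hub hvel _).trans (by simp only [hE]; gcongr)
    have hτ := exitT_le_max (Ξ := Ξ) hback hfwd
    refine ⟨hv0, ?_, hτ, fun γ hγ => ?_⟩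
    · refine (actionCost_le_add_headCost hg hvel hσ hfwd hgg).trans ?_
      gcongr
      exact hhead.trans le_self_add
    · obtain ⟨gγ, hgγ⟩ := exists_hasVel_of_actionCost_ne_top hγ
      refine (interCost_le_add_headCost hα hβ hβθ hC hlb hℓ hhub hg hvel hgγ hσ hfwd hgg
        hτ).trans ?_
      exact add_le_add le_rfl (add_le_add (le_trans (by gcongr) le_add_self) le_rfl)
end Approximation

section Game
theorem add_liminf_le_liminf_add (u v : ℕ → ℝ≥0∞) :
    liminf u atTop + liminf v atTop ≤ liminf (fun n => u n + v n) atTop := by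
  simp only [liminf_eq_iSup_iInf_of_nat]
  rw [ENNReal.iSup_add_iSup_of_monotone]
  · exact iSup_mono fun n => le_iInf₂ fun i hi =>
      add_le_add (iInf₂_le i hi) (iInf₂_le i hi)
  all_goals exact fun m n hmn => le_iInf₂ fun i hi => iInf₂_le i (hmn.trans hi)

variable {Ω Ξ : Set (EucSp d)} {ℓ : ℝ → EucSp d → EucSp d → ℝ}
  {h : ℝ → EucSp d → EucSp d → EucSp d → EucSp d → ℝ} {Ψ : ℝ → ℝ} {α θ C β αast : ℝ}

/-- Growth and regularity conditions on the running cost `ℓ` and the interaction cost `h`. -/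
structure CostBounds (Ω : Set (EucSp d)) (ℓ : ℝ → EucSp d → EucSp d → ℝ)
    (h : ℝ → EucSp d → EucSp d → EucSp d → EucSp d → ℝ) (α θ C β αast : ℝ) : Prop where
  pos_α : 0 < α
  one_lt_θ : 1 < θ
  pos_C : 0 < C
  pos_β : 0 < β
  β_le_θ : β ≤ θ
  nonneg_αast : 0 ≤ αast
  lb : ∀ t ∈ Ici (0 : ℝ), ∀ x ∈ closure Ω, ∀ p, α * ‖p‖ ^ θ ≤ ℓ t x p
  ub : ∀ t ∈ Ici (0 : ℝ), ∀ x ∈ closure Ω, ∀ p, ℓ t x p ≤ αast * ‖p‖ ^ θ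
  tonelli : TonelliIntegrand (closure Ω) ℓ
  tonelli_pair : TonelliIntegrand (pairSet (closure Ω)) fun t v w => h t v.fst v.snd w.fst w.snd
  hub : ∀ t ∈ Ici (0 : ℝ), ∀ x ∈ closure Ω, ∀ x' ∈ closure Ω, ∀ p p',
      h t x x' p p' ≤ C * (‖p‖ ^ β + ‖p'‖ ^ β)

/-- The total cost of a curve against a population `Q`. -/
def totalCost (ℓ : ℝ → EucSp d → EucSp d → ℝ) (Ψ : ℝ → ℝ)
    (h : ℝ → EucSp d → EucSp d → EucSp d → EucSp d → ℝ) (Ξ : Set (EucSp d))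
    (Q : Measure (CurveSp Ω)) (γ : CurveSp Ω) : ℝ≥0∞ :=
  Lcost ℓ Ψ Ξ γ + ∫⁻ γ', interCost h Ξ γ γ' ∂Q

theorem actionCost_le_totalCost {Q : Measure (CurveSp Ω)} (γ : CurveSp Ω) :
    actionCost ℓ γ ≤ totalCost ℓ Ψ h Ξ Q γ :=
  le_trans le_self_add (le_self_add : Lcost ℓ Ψ Ξ γ ≤ _)

theorem CostBounds.ae_actionCost_ne_top (H : CostBounds Ω ℓ h α θ C β αast)
    {Q : Measure (CurveSp Ω)} (hQ : ∫⁻ γ, actionCost ℓ γ ∂Q ≠ ⊤) :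
    ∀ᵐ γ ∂Q, actionCost ℓ γ ≠ ⊤ := by
  have hA := lowerSemicontinuous_actionCost H.pos_α H.one_lt_θ H.lb H.tonelli
  filter_upwards [ae_lt_top hA.measurable hQ] with γ hγ using hγ.ne

theorem CostBounds.totalCost_le_liminf (H : CostBounds Ω ℓ h α θ C β αast) (hΞ : IsClosed Ξ)
    (hΨlsc : LowerSemicontinuousOn Ψ (Ici 0)) {Q : Measure (CurveSp Ω)}
    (hQ : ∫⁻ γ, actionCost ℓ γ ∂Q ≠ ⊤) {u : ℕ → CurveSp Ω} {γ : CurveSp Ω}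
    (hu : Tendsto u atTop (𝓝 γ)) {R : ℝ≥0∞} (hR : R ≠ ⊤) (hle : ∀ n, actionCost ℓ (u n) ≤ R) :
    totalCost ℓ Ψ h Ξ Q γ ≤ liminf (fun n => totalCost ℓ Ψ h Ξ Q (u n)) atTop := by
  have hfin := H.ae_actionCost_ne_top hQ
  have h1 : Lcost ℓ Ψ Ξ γ ≤ liminf (fun n => Lcost ℓ Ψ Ξ (u n)) atTop := by
    have hlsc := lowerSemicontinuous_Lcost H.pos_α H.one_lt_θ H.lb H.tonelli hΞ hΨlsc
    refine le_liminf_of_tendsto (P := fun _ => True) (fun w x hw _ c hc => ?_) hu fun _ => trivial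
    exact (hlsc.isClosed_preimage c).mem_of_tendsto hw (Eventually.of_forall hc)
  have h2 : ∫⁻ γ', interCost h Ξ γ γ' ∂Q ≤
      liminf (fun n => ∫⁻ γ', interCost h Ξ (u n) γ' ∂Q) atTop := by
    refine le_trans (lintegral_mono_ae ?_) (lintegral_liminf_le' fun n =>
      aemeasurable_interCost H.pos_α H.one_lt_θ H.lb H.tonelli hΞ H.tonelli_pair hfin
        (ne_top_of_le_ne_top hR (hle n)))
    filter_upwards [hfin] with γ' hγ'
    refine le_liminf_of_tendsto (F := fun w => interCost h Ξ w γ')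
      (P := fun w => actionCost ℓ w ≤ R) (fun w x hw hP c hc => ?_) hu hle
    exact interCost_le_of_tendsto hΞ H.pos_α H.one_lt_θ H.lb H.tonelli_pair hw tendsto_const_nhds
      (R := R + actionCost ℓ γ') (by simp [hR, hγ']) (fun n => (hP n).trans le_self_add)
      (fun n => le_add_self) hc
  exact (add_le_add h1 h2).trans (add_liminf_le_liminf_add _ _)

theorem CostBounds.totalCost_le_of_tendsto (H : CostBounds Ω ℓ h α θ C β αast) (hΞ : IsClosed Ξ)
    (hΨlsc : LowerSemicontinuousOn Ψ (Ici 0)) {Q : Measure (CurveSp Ω)}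
    (hQ : ∫⁻ γ, actionCost ℓ γ ∂Q ≠ ⊤) {u : ℕ → CurveSp Ω} {γ : CurveSp Ω}
    (hu : Tendsto u atTop (𝓝 γ)) {c : ℝ≥0∞} (hc : c ≠ ⊤) {η : ℕ → ℝ≥0∞}
    (hη : Tendsto η atTop (𝓝 0)) (hle : ∀ᶠ n in atTop, totalCost ℓ Ψ h Ξ Q (u n) ≤ c + η n) :
    totalCost ℓ Ψ h Ξ Q γ ≤ c := by
  obtain ⟨N, hN⟩ := eventually_atTop.1
    (hle.and (hη.eventually (ge_mem_nhds (show (0 : ℝ≥0∞) < 1 by simp))))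
  have hu' := hu.comp (tendsto_add_atTop_nat N)
  have hη' := (hη.comp (tendsto_add_atTop_nat N)).const_add c
  refine (H.totalCost_le_liminf hΞ hΨlsc hQ hu' (R := c + 1) (by simp [hc]) fun n => ?_).trans ?_
  · obtain ⟨h1, h2⟩ := hN (n + N) (by simp)
    exact (actionCost_le_totalCost _).trans (h1.trans (by gcongr))
  · refine (liminf_le_liminf (Eventually.of_forall fun n => (hN (n + N) (by simp)).1)).trans ?_
    rw [add_zero] at hη'
    exact hη'.liminf_eq.le

theorem CostBounds.lintegral_interCost_le (H : CostBounds Ω ℓ h α θ C β αast)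
    {Q : Measure (CurveSp Ω)} [IsProbabilityMeasure Q] (hQ : ∫⁻ γ, actionCost ℓ γ ∂Q ≠ ⊤)
    {v ω : CurveSp Ω} {e K : ℝ≥0∞} {σ : ℝ} (hK : K ≠ ⊤)
    (hle : ∀ γ : CurveSp Ω, actionCost ℓ γ ≠ ⊤ →
      interCost h Ξ v γ ≤ interCost h Ξ ω γ + (e + K * headCost ℓ σ γ)) :
    ∫⁻ γ, interCost h Ξ v γ ∂Q ≤
      ∫⁻ γ, interCost h Ξ ω γ ∂Q + (e + K * ∫⁻ γ, headCost ℓ σ γ ∂Q) := by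
  have hfin := H.ae_actionCost_ne_top hQ
  have hm := (aemeasurable_headCost H.pos_α H.one_lt_θ H.lb H.tonelli hfin σ).const_mul K
  calc _ ≤ ∫⁻ γ, (interCost h Ξ ω γ + (e + K * headCost ℓ σ γ)) ∂Q := by
        refine lintegral_mono_ae ?_
        filter_upwards [hfin] with γ hγ using hle γ hγ
    _ = _ := by
        have h1 : ∫⁻ γ, (e + K * headCost ℓ σ γ) ∂Q = e + K * ∫⁻ γ, headCost ℓ σ γ ∂Q := by
          rw [lintegral_add_right' _ hm, lintegral_const_mul' _ _ hK]
          simp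
        rw [← h1]
        exact lintegral_add_right' _ (aemeasurable_const.add hm)

theorem CostBounds.exists_approx (H : CostBounds Ω ℓ h α θ C β αast) {Q : Measure (CurveSp Ω)}
    [IsProbabilityMeasure Q] (hQ : ∫⁻ γ, actionCost ℓ γ ∂Q ≠ ⊤) {ω : CurveSp Ω}
    (hω : actionCost ℓ ω ≠ ⊤) {u : ℕ → EucSp d}
    (hu : Tendsto (fun n => geoDist (closure Ω) (u n) (ω.1 0)) atTop (𝓝 0)) :
    ∃ (v : ℕ → CurveSp Ω) (σ η : ℕ → ℝ≥0∞), Tendsto σ atTop (𝓝 0) ∧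
      Tendsto η atTop (𝓝 0) ∧ ∀ᶠ n in atTop, (v n).1 0 = u n ∧
        totalCost ℓ Ψ h Ξ Q (v n) ≤ actionCost ℓ ω + PsiExt Ψ (max (exitT Ξ ω) (σ n)) +
          ∫⁻ γ, interCost h Ξ ω γ ∂Q + η n := by
  obtain ⟨v, σ, e, hσ, he, hv⟩ := exists_approx_of_tendsto_geoDist (Ξ := Ξ) H.pos_α
    (zero_le_one.trans H.one_lt_θ.le) H.pos_β H.β_le_θ H.pos_C H.nonneg_αast H.lb H.ub H.tonelli
    H.hub hω hu
  refine ⟨v, fun n => ENNReal.ofReal (σ n), fun n => e n + (e n + ENNReal.ofReal (C / α) *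
    ∫⁻ γ, headCost ℓ (σ n) γ ∂Q), by simpa using ENNReal.tendsto_ofReal hσ, ?_, ?_⟩
  · have h1 := ENNReal.Tendsto.const_mul (a := ENNReal.ofReal (C / α))
      (tendsto_lintegral_headCost H.pos_α H.one_lt_θ H.lb H.tonelli hQ hσ)
      (Or.inr ENNReal.ofReal_ne_top)
    simpa using he.add (he.add h1)
  · filter_upwards [hv] with n ⟨h0, hA, hτ, hI⟩
    refine ⟨h0, ?_⟩
    have h1 := H.lintegral_interCost_le hQ ENNReal.ofReal_ne_top hI
    have h2 := PsiExt_mono Ψ hτ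
    calc totalCost ℓ Ψ h Ξ Q (v n) = actionCost ℓ (v n) + PsiExt Ψ (exitT Ξ (v n)) +
          ∫⁻ γ, interCost h Ξ (v n) γ ∂Q := rfl
      _ ≤ _ := add_le_add (add_le_add hA h2) h1
      _ = _ := by ring

theorem exitT_eq_zero {γ : CurveSp Ω} (hγ : γ.1 0 ∈ Ξ) : exitT Ξ γ = 0 :=
  le_antisymm (iInf₂_le (0 : ℝ≥0) hγ) zero_le

theorem exitT_pos (hΞ : IsClosed Ξ) {γ : CurveSp Ω} (hγ : γ.1 0 ∉ Ξ) : 0 < exitT Ξ γ := by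
  refine (lt_exitT_iff hΞ 0 γ).2 fun t ht => ?_
  rw [Icc_self, mem_singleton_iff] at ht
  rwa [ht]

theorem CostBounds.lintegral_interCost_eq_zero (H : CostBounds Ω ℓ h α θ C β αast)
    {Q : Measure (CurveSp Ω)} (hQ : ∫⁻ γ, actionCost ℓ γ ∂Q ≠ ⊤) {γ : CurveSp Ω}
    (hγ : actionCost ℓ γ ≠ ⊤) (h0 : γ.1 0 ∈ Ξ) : ∫⁻ γ', interCost h Ξ γ γ' ∂Q = 0 := by
  refine lintegral_eq_zero_of_ae_eq_zero ?_
  filter_upwards [H.ae_actionCost_ne_top hQ] with γ' hγ'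
  obtain ⟨g, hg⟩ := exists_hasVel_of_actionCost_ne_top hγ
  obtain ⟨g', hg'⟩ := exists_hasVel_of_actionCost_ne_top hγ'
  rw [hg.interCost_eq hg', exitT_eq_zero h0]
  simp

theorem CostBounds.exists_const (H : CostBounds Ω ℓ h α θ C β αast) {x : EucSp d}
    (hx : x ∈ closure Ω) : ∃ γ : CurveSp Ω, γ.1 0 = x ∧ actionCost ℓ γ = 0 := by
  refine ⟨⟨ContinuousMap.const _ x, fun _ => hx⟩, rfl, le_antisymm ?_ zero_le⟩
  refine (iInf₂_le (fun _ => 0) ⟨fun T => by simp, fun t => by simp⟩).trans (le_of_eq ?_)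
  refine (setLIntegral_congr_fun measurableSet_Ioi fun t ht => ?_).trans lintegral_zero
  refine ENNReal.ofReal_eq_zero.2 ?_
  have hθ : θ ≠ 0 := (zero_lt_one.trans H.one_lt_θ).ne'
  simpa [Real.zero_rpow hθ] using H.ub t (show (0 : ℝ) ≤ t from le_of_lt ht) x hx 0
end Game

section Stability
variable {Ω Ξ : Set (EucSp d)} {ℓ : ℝ → EucSp d → EucSp d → ℝ}
  {h : ℝ → EucSp d → EucSp d → EucSp d → EucSp d → ℝ} {Ψ : ℝ → ℝ} {α θ C β αast : ℝ}

/-- Limits of optimal curves starting on the target set have zero action. -/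
theorem CostBounds.actionCost_eq_zero_of_tendsto (H : CostBounds Ω ℓ h α θ C β αast)
    (hΞ : IsClosed Ξ) (hΨmono : MonotoneOn Ψ (Ici 0)) {Q : Measure (CurveSp Ω)}
    [IsProbabilityMeasure Q] (hQ : ∫⁻ γ, actionCost ℓ γ ∂Q ≠ ⊤) {u : ℕ → CurveSp Ω}
    {γ : CurveSp Ω} (hu : Tendsto u atTop (𝓝 γ))
    (hgeo : Tendsto (fun n => geoDist (closure Ω) ((u n).1 0) (γ.1 0)) atTop (𝓝 0))
    (hopt : ∀ n, ∀ ω : CurveSp Ω, ω.1 0 = (u n).1 0 →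
      totalCost ℓ Ψ h Ξ Q (u n) ≤ totalCost ℓ Ψ h Ξ Q ω)
    (h0 : γ.1 0 ∈ Ξ) : actionCost ℓ γ = 0 := by
  set P₀ : ℝ≥0∞ := ⨅ (T : ℝ≥0∞) (_ : 0 < T), PsiExt Ψ T with hP₀
  have hP₀top : P₀ ≠ ⊤ := by
    refine ne_top_of_le_ne_top (ENNReal.ofReal_ne_top (r := Ψ (1 : ℝ≥0))) ?_
    rw [← PsiExt_coe hΨmono]
    exact iInf₂_le _ (by simp)
  obtain ⟨ω, hω0, hωA⟩ := H.exists_const (γ.2 0)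
  obtain ⟨v, σ, η, hσ, hη, hv⟩ := H.exists_approx (Ψ := Ψ) (Ξ := Ξ) hQ (ω := ω) (by simp [hωA])
    (u := fun n => (u n).1 0) (by rwa [hω0])
  have hωτ : exitT Ξ ω = 0 := exitT_eq_zero (by rwa [hω0])
  have hωI := H.lintegral_interCost_eq_zero hQ (by simp [hωA] : actionCost ℓ ω ≠ ⊤)
    (by rwa [hω0] : ω.1 0 ∈ Ξ)
  have key : ∀ ε : ℝ≥0∞, 0 < ε → ∀ᶠ n in atTop, actionCost ℓ (u n) ≤ ε := by
    intro ε hε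
    have hε2 : (0 : ℝ≥0∞) < ε / 2 := ENNReal.half_pos hε.ne'
    obtain ⟨T, hT, hPT⟩ : ∃ T : ℝ≥0∞, 0 < T ∧ PsiExt Ψ T < P₀ + ε / 2 := by
      have h1 : P₀ < P₀ + ε / 2 := ENNReal.lt_add_right hP₀top hε2.ne'
      conv_lhs at h1 => rw [hP₀]
      simpa only [iInf_lt_iff, exists_prop] using h1
    filter_upwards [hv, hσ.eventually (gt_mem_nhds hT), hη.eventually (gt_mem_nhds hε2)]
      with n ⟨hvn, hcost⟩ hσn hηn
    by_cases hn : (u n).1 0 ∈ Ξ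
    · obtain ⟨ω', hω'0, hω'A⟩ := H.exists_const ((u n).2 0)
      have hle := hopt n ω' hω'0
      have hI := H.lintegral_interCost_eq_zero hQ (by simp [hω'A] : actionCost ℓ ω' ≠ ⊤)
        (by rwa [hω'0] : ω'.1 0 ∈ Ξ)
      have hP : PsiExt Ψ 0 ≠ ⊤ := by
        have := PsiExt_coe hΨmono 0
        rw [ENNReal.coe_zero] at this
        simp [this]
      have h2 : actionCost ℓ (u n) + PsiExt Ψ 0 ≤ 0 + PsiExt Ψ 0 := by
        calc actionCost ℓ (u n) + PsiExt Ψ 0 = Lcost ℓ Ψ Ξ (u n) := by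
              rw [Lcost_eq, exitT_eq_zero hn]
          _ ≤ totalCost ℓ Ψ h Ξ Q (u n) := le_self_add
          _ ≤ totalCost ℓ Ψ h Ξ Q ω' := hle
          _ = 0 + PsiExt Ψ 0 := by
              rw [totalCost, Lcost_eq, hω'A, hI, exitT_eq_zero (by rwa [hω'0]), add_zero]
      exact ((ENNReal.add_le_add_iff_right hP).1 h2).trans zero_le
    · have h2 : actionCost ℓ (u n) + P₀ ≤ ε + P₀ := by
        calc actionCost ℓ (u n) + P₀ ≤ Lcost ℓ Ψ Ξ (u n) := by
              rw [Lcost_eq]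
              exact add_le_add le_rfl (iInf₂_le _ (exitT_pos hΞ hn))
          _ ≤ totalCost ℓ Ψ h Ξ Q (u n) := le_self_add
          _ ≤ totalCost ℓ Ψ h Ξ Q (v n) := hopt n _ hvn
          _ ≤ PsiExt Ψ (σ n) + η n := by simpa [hωA, hωτ, hωI] using hcost
          _ ≤ (P₀ + ε / 2) + ε / 2 :=
              add_le_add ((PsiExt_mono Ψ hσn.le).trans hPT.le) hηn.le
          _ = ε + P₀ := by rw [add_assoc, ENNReal.add_halves, add_comm]
      exact (ENNReal.add_le_add_iff_right hP₀top).1 h2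
  have hlsc := lowerSemicontinuous_actionCost H.pos_α H.one_lt_θ H.lb H.tonelli
  refine le_antisymm (le_of_forall_gt_imp_ge_of_dense fun ε hε => ?_) zero_le
  exact (hlsc.isClosed_preimage ε).mem_of_tendsto hu (key ε hε)

/-- A limit of optimal curves is optimal. -/
theorem CostBounds.totalCost_le_of_tendsto_optimal (H : CostBounds Ω ℓ h α θ C β αast)
    (hΞ : IsClosed Ξ) (hΨlsc : LowerSemicontinuousOn Ψ (Ici 0)) (hΨmono : MonotoneOn Ψ (Ici 0))
    {Q : Measure (CurveSp Ω)} [IsProbabilityMeasure Q] (hQ : ∫⁻ γ, actionCost ℓ γ ∂Q ≠ ⊤)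
    {u : ℕ → CurveSp Ω} {γ : CurveSp Ω} (hu : Tendsto u atTop (𝓝 γ))
    (hgeo : Tendsto (fun n => geoDist (closure Ω) ((u n).1 0) (γ.1 0)) atTop (𝓝 0))
    (hopt : ∀ n, ∀ ω : CurveSp Ω, ω.1 0 = (u n).1 0 →
      totalCost ℓ Ψ h Ξ Q (u n) ≤ totalCost ℓ Ψ h Ξ Q ω)
    {ω : CurveSp Ω} (hω : ω.1 0 = γ.1 0) :
    totalCost ℓ Ψ h Ξ Q γ ≤ totalCost ℓ Ψ h Ξ Q ω := by
  by_cases h0 : γ.1 0 ∈ Ξ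
  · have hA := H.actionCost_eq_zero_of_tendsto hΞ hΨmono hQ hu hgeo hopt h0
    have hI := H.lintegral_interCost_eq_zero hQ (by simp [hA] : actionCost ℓ γ ≠ ⊤) h0
    calc totalCost ℓ Ψ h Ξ Q γ = PsiExt Ψ (exitT Ξ ω) := by
          rw [totalCost, Lcost_eq, hA, hI, exitT_eq_zero h0, exitT_eq_zero (by rwa [hω]), zero_add,
            add_zero]
      _ ≤ Lcost ℓ Ψ Ξ ω := le_add_self
      _ ≤ totalCost ℓ Ψ h Ξ Q ω := le_self_add
  · rcases eq_or_ne (totalCost ℓ Ψ h Ξ Q ω) ⊤ with htop | htop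
    · rw [htop]
      exact le_top
    obtain ⟨v, σ, η, hσ, hη, hv⟩ := H.exists_approx (Ψ := Ψ) (Ξ := Ξ) hQ (ω := ω)
      (ne_top_of_le_ne_top htop (actionCost_le_totalCost ω)) (u := fun n => (u n).1 0)
      (by rwa [hω])
    refine H.totalCost_le_of_tendsto hΞ hΨlsc hQ hu htop hη ?_
    filter_upwards [hv, hσ.eventually (gt_mem_nhds (exitT_pos hΞ (by rwa [hω] : ω.1 0 ∉ Ξ)))]
      with n ⟨hvn, hcost⟩ hσn
    refine (hopt n _ hvn).trans (hcost.trans (le_of_eq ?_))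
    rw [max_eq_left hσn.le]
    rfl

theorem F1cost_eq_totalCost {Q : Measure (CurveSp Ω)} [IsProbabilityMeasure Q]
    (hQ : ∫⁻ γ, F1cost ℓ Ψ h Ξ γ Q ∂Q ≠ ⊤) (γ : CurveSp Ω) :
    F1cost ℓ Ψ h Ξ γ Q = totalCost ℓ Ψ h Ξ Q γ := by
  refine if_pos ?_
  by_contra hne
  refine hQ ?_
  simp only [F1cost, if_neg hne, lintegral_const, measure_univ, mul_one]

end Stability

/-- Theorem `thm:3:equiv`: under (H1)–(H8), `Q` is an equilibrium of the mean field game with initial condition `m₀` if and only if it is a strong equilibrium (optimality at every point of the support of `Q`). -/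
theorem equilibrium_iff_strong_equilibrium_MFG {d : ℕ}
    (Ω : Set (EucSp d)) (hΩne : Ω.Nonempty) (hΩop : IsOpen Ω)
    (hΩbd : Bornology.IsBounded Ω)
    (Ξ : Set (EucSp d)) (hΞne : Ξ.Nonempty) (hΞcl : IsClosed Ξ) (hΞsub : Ξ ⊆ closure Ω)
    (ℓ : ℝ → EucSp d → EucSp d → ℝ)
    (hℓmeas : ∀ x p, Measurable fun t : ℝ => ℓ t x p)
    (hℓcont : ∀ᵐ t ∂(volume.restrict (Set.Ioi (0 : ℝ))),
      ContinuousOn (fun q : EucSp d × EucSp d => ℓ t q.1 q.2)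
        ((closure Ω) ×ˢ (Set.univ : Set (EucSp d))))
    (hℓconv : ∀ᵐ t ∂(volume.restrict (Set.Ioi (0 : ℝ))), ∀ x ∈ closure Ω,
      ConvexOn ℝ Set.univ fun p => ℓ t x p)
    (hℓnn : ∀ t ∈ Set.Ici (0 : ℝ), ∀ x ∈ closure Ω, ∀ p, 0 ≤ ℓ t x p)
    (α θ : ℝ) (hα : 0 < α) (hθ : 1 < θ)
    (hℓlb : ∀ t ∈ Set.Ici (0 : ℝ), ∀ x ∈ closure Ω, ∀ p, α * ‖p‖ ^ θ ≤ ℓ t x p)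
    (h : ℝ → EucSp d → EucSp d → EucSp d → EucSp d → ℝ)
    (hhmeas : ∀ x x' p p', Measurable fun t : ℝ => h t x x' p p')
    (hhcont : ∀ᵐ t ∂(volume.restrict (Set.Ioi (0 : ℝ))),
      ContinuousOn
        (fun q : (EucSp d × EucSp d) × EucSp d × EucSp d => h t q.1.1 q.1.2 q.2.1 q.2.2)
        (((closure Ω) ×ˢ (closure Ω)) ×ˢ (Set.univ : Set (EucSp d × EucSp d))))
    (hhconv : ∀ᵐ t ∂(volume.restrict (Set.Ioi (0 : ℝ))), ∀ x ∈ closure Ω, ∀ x' ∈ closure Ω,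
      ConvexOn ℝ Set.univ fun q : EucSp d × EucSp d => h t x x' q.1 q.2)
    (hhsymm : ∀ t x x' p p', h t x x' p p' = h t x' x p' p)
    (hhnn : ∀ t ∈ Set.Ici (0 : ℝ), ∀ x ∈ closure Ω, ∀ x' ∈ closure Ω, ∀ p p',
      0 ≤ h t x x' p p')
    (C β : ℝ) (hC : 0 < C) (hβ : 0 < β) (hβθ : β ≤ θ)
    (hhub : ∀ t ∈ Set.Ici (0 : ℝ), ∀ x ∈ closure Ω, ∀ x' ∈ closure Ω, ∀ p p',
      h t x x' p p' ≤ C * (‖p‖ ^ β + ‖p'‖ ^ β))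
    (Ψ : ℝ → ℝ) (hΨnn : ∀ t ∈ Set.Ici (0 : ℝ), 0 ≤ Ψ t)
    (hΨlsc : LowerSemicontinuousOn Ψ (Set.Ici 0)) (hΨmono : MonotoneOn Ψ (Set.Ici 0))
    (a b : ℝ) (ha : 0 < a) (hb : 0 < b)
    (hΨlb : ∀ t ∈ Set.Ici (0 : ℝ), a * t - b ≤ Ψ t)
    (κ : ℝ) (hκ : 0 < κ)
    (hH6 : ∀ x₀ ∈ closure Ω, ∃ γ : CurveSp Ω, γ.1 0 = x₀ ∧ Lcost ℓ Ψ Ξ γ ≤ ENNReal.ofReal κ)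
    (hH7 : ∀ x ∈ closure Ω, ∀ u : ℕ → EucSp d, (∀ n, u n ∈ closure Ω) →
      Tendsto u atTop (𝓝 x) →
      Tendsto (fun n => geoDist (closure Ω) (u n) x) atTop (𝓝 (0 : ℝ≥0∞)))
    (αast : ℝ) (hαast : 0 < αast)
    (hℓub : ∀ t ∈ Set.Ici (0 : ℝ), ∀ x ∈ closure Ω, ∀ p, ℓ t x p ≤ αast * ‖p‖ ^ θ)
    (m₀ : Measure (EucSp d)) (hm₀ : IsProbabilityMeasure m₀) (hm₀supp : m₀ (closure Ω) = 1)
    (Q : Measure (CurveSp Ω)) (hQ : IsProbabilityMeasure Q) :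
    ((Q.map (fun γ : CurveSp Ω => γ.1 0) = m₀ ∧
      (∫⁻ γ, F1cost ℓ Ψ h Ξ γ Q ∂Q) ≠ ⊤ ∧
      ∀ᵐ γ ∂Q, F1cost ℓ Ψ h Ξ γ Q =
        ⨅ (ω : CurveSp Ω) (_ : ω.1 0 = γ.1 0), F1cost ℓ Ψ h Ξ ω Q)
    ↔
    (Q.map (fun γ : CurveSp Ω => γ.1 0) = m₀ ∧
      (∫⁻ γ, F1cost ℓ Ψ h Ξ γ Q ∂Q) ≠ ⊤ ∧
      ∀ γ : CurveSp Ω, (∀ U : Set (CurveSp Ω), IsOpen U → γ ∈ U → 0 < Q U) →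
        F1cost ℓ Ψ h Ξ γ Q =
          ⨅ (ω : CurveSp Ω) (_ : ω.1 0 = γ.1 0), F1cost ℓ Ψ h Ξ ω Q)) := by
  refine and_congr_right fun _ => and_congr_right fun hfin => ?_
  have hF := F1cost_eq_totalCost hfin
  simp only [hF] at hfin ⊢
  have hA : ∫⁻ γ, actionCost ℓ γ ∂Q ≠ ⊤ :=
    ne_top_of_le_ne_top hfin (lintegral_mono fun γ => actionCost_le_totalCost γ)
  have hθ0 : θ ≠ 0 := (zero_lt_one.trans hθ).ne'
  have H : CostBounds Ω ℓ h α θ C β αast :=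
    { pos_α := hα
      one_lt_θ := hθ
      pos_C := hC
      pos_β := hβ
      β_le_θ := hβθ
      nonneg_αast := hαast.le
      lb := hℓlb
      ub := hℓub
      tonelli :=
        { meas := hℓmeas
          cont := hℓcont
          conv := hℓconv
          nonneg := hℓnn
          bdd := fun M => ⟨αast * |M| ^ θ, fun t ht x hx p hp => (hℓub t ht x hx p).trans (by
            have := hp.trans (le_abs_self M)
            have := (zero_lt_one.trans hθ).le
            gcongr)⟩
          zero := fun t ht x hx => by simpa [Real.zero_rpow hθ0] using hℓub t ht x hx 0 }
      tonelli_pair := tonelliIntegrand_pair hC hβ hhmeas hhcont hhconv hhnn hhub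
      hub := hhub }
  constructor
  · intro hae γ hγ
    have hcl : γ ∈ closure {w : CurveSp Ω | totalCost ℓ Ψ h Ξ Q w =
        ⨅ (ω : CurveSp Ω) (_ : ω.1 0 = w.1 0), totalCost ℓ Ψ h Ξ Q ω} := by
      refine mem_closure_iff.2 fun U hU hγU => ?_
      by_contra hemp
      have hnull : Q U = 0 := measure_mono_null
        (fun w hw (hgood : w ∈ {w : CurveSp Ω | _}) => hemp ⟨w, hw, hgood⟩) (ae_iff.1 hae)
      exact (hγ U hU hγU).ne' hnull
    obtain ⟨u, hu, hlim⟩ := mem_closure_iff_seq_limit.1 hcl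
    have h0 : Tendsto (fun n => (u n).1 0) atTop (𝓝 (γ.1 0)) :=
      (((continuous_eval_const (0 : ℝ≥0)).comp continuous_subtype_val).tendsto γ).comp hlim
    refine le_antisymm (le_iInf₂ fun ω hω => ?_) (iInf₂_le
      (f := fun (ω : CurveSp Ω) (_ : ω.1 0 = γ.1 0) => totalCost ℓ Ψ h Ξ Q ω) γ rfl)
    refine H.totalCost_le_of_tendsto_optimal hΞcl hΨlsc hΨmono hA hlim
      (hH7 _ (γ.2 0) _ (fun n => (u n).2 0) h0) (fun n ω hω => ?_) hω
    exact (hu n).trans_le (iInf₂_le ω hω)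
  · intro hall
    refine measure_null_of_locally_null _ fun γ hγ => ?_
    by_contra! hne
    refine hγ (hall γ fun U hU hγU => pos_iff_ne_zero.2 ?_)
    exact hne U (mem_nhdsWithin_of_mem_nhds (hU.mem_nhds hγU))

end
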